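/- Let ν, μ > 0 with |ν − μ| > 2. Then the positive zeros of J_ν′ and J_μ′ are NOT interlaced on (0,∞), and the positive zeros of Y_ν′ and Y_μ′ are NOT interlaced on (0,∞), where primes denote derivatives with respect to x. -/

import Mathlib

open Real Filter Topology Set

/-- Bessel function of the first kind of real order `ν`:
`J_ν(x) = ∑ ((−1)^m / (m! Γ(m+ν+1))) (x/2)^{2m+ν}` (with `1/Γ = 0` at nonpositive
integers, which agrees with Lean's `1/0 = 0` since `Real.Gamma` vanishes there). -/
noncomputable def besselJ (ν : ℝ) (x : ℝ) : ℝ :=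
  ∑' m : ℕ, ((-1 : ℝ) ^ m / (m.factorial * Real.Gamma ((m : ℝ) + ν + 1))) *
    (x / 2) ^ (2 * (m : ℝ) + ν)

/-- Bessel function of the second kind, characterized as the limit
`(J_μ(x) cos(μπ) − J_{−μ}(x)) / sin(μπ) → Y_ν(x)` as `μ → ν` through non-integer reals. -/
noncomputable def besselY (ν : ℝ) (x : ℝ) : ℝ :=
  limUnder (𝓝[{μ : ℝ | ∀ n : ℤ, μ ≠ (n : ℝ)}] ν)
    (fun μ : ℝ => (besselJ μ x * Real.cos (μ * π) - besselJ (-μ) x) / Real.sin (μ * π))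

/-- The cylinder function `C_ν(x) = cos δ · J_ν(x) − sin δ · Y_ν(x)`. -/
noncomputable def cylinder (δ ν : ℝ) (x : ℝ) : ℝ :=
  Real.cos δ * besselJ ν x - Real.sin δ * besselY ν x

/-- One direction of the interlacing property: between any two consecutive zeros of `f`
in `I` there is exactly one zero of `g`. -/
def InterlaceHalf (f g : ℝ → ℝ) (I : Set ℝ) : Prop :=
  ∀ x₁ ∈ I, ∀ x₂ ∈ I, x₁ < x₂ → f x₁ = 0 → f x₂ = 0 →
    (∀ x ∈ Set.Ioo x₁ x₂, f x ≠ 0) →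
    ∃! x, x ∈ Set.Ioo x₁ x₂ ∧ g x = 0

/-- `f` and `g` have interlaced zeros on `I`. -/
def InterlacedOn (f g : ℝ → ℝ) (I : Set ℝ) : Prop :=
  InterlaceHalf f g I ∧ InterlaceHalf g f I

namespace BD

/-- coefficients -/
noncomputable def cf (ν : ℝ) (m : ℕ) : ℝ := (-1 : ℝ) ^ m / (m.factorial * Real.Gamma ((m : ℝ) + ν + 1))

noncomputable def gs (ν y : ℝ) : ℝ := ∑' m : ℕ, cf ν m * y ^ m

lemma inv_Gamma_rec (s : ℝ) : 1 / Real.Gamma s = s / Real.Gamma (s + 1) := by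
  by_cases hs : s = 0
  · subst hs; simp [Real.Gamma_zero]
  · rw [Real.Gamma_add_one hs]
    field_simp

lemma cf_bound (ν : ℝ) : ∃ C : ℝ, 0 ≤ C ∧ ∀ m : ℕ, |cf ν m| ≤ C / m.factorial := by
  have h1 : ∃ C : ℝ, ∀ m : ℕ, |1 / Real.Gamma ((m : ℝ) + ν + 1)| ≤ C := by
    obtain ⟨N, hN⟩ := exists_nat_gt (1 - ν)
    have hb : ∀ m ∈ Set.Ici N, |1 / Real.Gamma ((m : ℝ) + ν + 1)| ≤ 1 := by
      intro m hm
      have hm' : (N : ℝ) ≤ m := by exact_mod_cast hm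
      have h2 : (2 : ℝ) ≤ (m : ℝ) + ν + 1 := by linarith
      have h3 : Real.Gamma 2 ≤ Real.Gamma ((m : ℝ) + ν + 1) :=
        Real.Gamma_strictMonoOn_Ici.monotoneOn (by simp) h2 h2
      rw [Real.Gamma_two] at h3
      rw [abs_of_nonneg (by positivity), div_le_one (by linarith)]
      exact h3
    refine ⟨1 + ∑ m ∈ Finset.range N, |1 / Real.Gamma ((m : ℝ) + ν + 1)|, fun m => ?_⟩
    by_cases hm : N ≤ m
    · have := hb m hm
      have h5 : 0 ≤ ∑ m ∈ Finset.range N, |1 / Real.Gamma ((m : ℝ) + ν + 1)| :=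
        Finset.sum_nonneg (fun _ _ => abs_nonneg _)
      linarith
    · have := Finset.single_le_sum (f := fun m : ℕ => |1 / Real.Gamma ((m : ℝ) + ν + 1)|)
        (fun _ _ => abs_nonneg _) (Finset.mem_range.mpr (not_le.mp hm))
      linarith
  obtain ⟨C, hC⟩ := h1
  refine ⟨C, (abs_nonneg _).trans (hC 0), fun m => ?_⟩
  have : cf ν m = (-1) ^ m * (1 / Real.Gamma ((m : ℝ) + ν + 1)) / m.factorial := by
    unfold cf; field_simp
  rw [this, abs_div, abs_mul, abs_pow, abs_neg, abs_one, one_pow, one_mul, Nat.abs_cast]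
  gcongr
  exact hC m

lemma gs_summable (ν y : ℝ) : Summable (fun m : ℕ => cf ν m * y ^ m) := by
  obtain ⟨C, hC0, hC⟩ := cf_bound ν
  refine Summable.of_norm_bounded (g := fun m : ℕ => C * (|y| ^ m / m.factorial))
    ((Real.summable_pow_div_factorial |y|).mul_left C) (fun m => ?_)
  rw [Real.norm_eq_abs, abs_mul, abs_pow]
  calc |cf ν m| * |y| ^ m ≤ C / m.factorial * |y| ^ m := by gcongr; exact hC m
    _ = _ := by ring

lemma cf_succ (ν : ℝ) (m : ℕ) : cf ν (m + 1) * (m + 1) = - cf (ν + 1) m := by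
  unfold cf
  rw [Nat.factorial_succ]
  push_cast
  rw [show (m : ℝ) + 1 + ν + 1 = m + (ν + 1) + 1 by ring]
  have : (m : ℝ) + 1 ≠ 0 := by positivity
  by_cases hG : Real.Gamma (m + (ν + 1) + 1) = 0
  · simp [hG]
  · field_simp
    ring

lemma gs_hasDerivAt (ν y : ℝ) : HasDerivAt (gs ν) (- gs (ν + 1) y) y := by
  obtain ⟨C, hC0, hC⟩ := cf_bound ν
  set r := |y| + 1 with hr
  have key : HasDerivAt (fun z => ∑' m : ℕ, cf ν m * z ^ m) (∑' m : ℕ, cf ν m * (m * y ^ (m - 1))) y := by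
    refine hasDerivAt_tsum_of_isPreconnected (g := fun (m : ℕ) (z : ℝ) => cf ν m * z ^ m)
      (g' := fun (m : ℕ) (z : ℝ) => cf ν m * (m * z ^ (m - 1))) (t := Metric.ball (0:ℝ) r) (y₀ := (0:ℝ))
      (u := fun m : ℕ => C * (m * r ^ (m - 1) / m.factorial)) ?_ Metric.isOpen_ball
      (convex_ball (0:ℝ) r).isPreconnected ?_ ?_ ?_ ?_ ?_
    · apply Summable.mul_left
      rw [← summable_nat_add_iff 1]
      refine (Real.summable_pow_div_factorial r).congr (fun m => ?_)
      rw [Nat.factorial_succ]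
      push_cast
      have : (m : ℝ) + 1 ≠ 0 := by positivity
      field_simp
    · intro m z _
      exact (hasDerivAt_pow m z).const_mul _
    · intro m z hz
      have hz' : |z| ≤ r := by
        rw [mem_ball_zero_iff, Real.norm_eq_abs] at hz; exact hz.le
      rw [Real.norm_eq_abs, abs_mul, abs_mul, abs_pow, Nat.abs_cast]
      calc |cf ν m| * (m * |z| ^ (m - 1)) ≤ C / m.factorial * (m * r ^ (m - 1)) := by
            gcongr; exact hC m
        _ = _ := by ring
    · simp [hr]; positivity
    · exact gs_summable ν 0
    · rw [mem_ball_zero_iff, Real.norm_eq_abs, hr]; linarith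
  have e : (∑' m : ℕ, cf ν m * (m * y ^ (m - 1))) = - gs (ν + 1) y := by
    have hs : Summable (fun m : ℕ => cf ν m * (m * y ^ (m - 1))) := by
      rw [← summable_nat_add_iff 1]
      refine ((gs_summable (ν + 1) y).neg).congr (fun m => ?_)
      have := cf_succ ν m
      rw [Nat.add_sub_cancel]
      push_cast
      linear_combination (- y ^ m) * this
    rw [hs.tsum_eq_zero_add, gs, ← tsum_neg]
    simp only [Nat.cast_zero, zero_mul, mul_zero, zero_add]
    congr 1
    ext m
    have := cf_succ ν m
    rw [Nat.add_sub_cancel]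
    push_cast
    linear_combination (y ^ m) * this
  rw [e] at key
  exact key

lemma gs_rec (ν y : ℝ) : gs (ν - 1) y = ν * gs ν y - y * gs (ν + 1) y := by
  have h1 : ∀ m : ℕ, cf (ν - 1) m = (m + ν) * cf ν m := by
    intro m
    have := inv_Gamma_rec (m + ν)
    unfold cf
    rw [show (m : ℝ) + (ν - 1) + 1 = m + ν by ring]
    have e1 : (-1 : ℝ) ^ m / (m.factorial * Real.Gamma (m + ν)) = (-1) ^ m / m.factorial * (1 / Real.Gamma (m + ν)) := by
      rw [div_mul_div_comm, mul_one]
    rw [e1, this]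
    field_simp
  have hs := gs_summable ν y
  have hs2 : Summable (fun m : ℕ => (m : ℝ) * cf ν m * y ^ m) := by
    refine ((gs_summable (ν - 1) y).sub (hs.mul_left ν)).congr (fun m => ?_)
    rw [h1]; ring
  have h3 : ∑' m : ℕ, (m : ℝ) * cf ν m * y ^ m = - y * gs (ν + 1) y := by
    rw [hs2.tsum_eq_zero_add, gs, ← tsum_mul_left]
    simp only [Nat.cast_zero, zero_mul, zero_add]
    congr 1
    ext m
    have := cf_succ ν m
    push_cast
    linear_combination (y ^ (m + 1)) * this
  unfold gs at *
  have : ∀ m : ℕ, cf (ν - 1) m * y ^ m = (m : ℝ) * cf ν m * y ^ m + ν * (cf ν m * y ^ m) := by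
    intro m; rw [h1]; ring
  simp_rw [this]
  rw [hs2.tsum_add (hs.mul_left ν), h3, tsum_mul_left]
  ring

lemma gs_zero (ν : ℝ) : gs ν 0 = 1 / Real.Gamma (ν + 1) := by
  unfold gs
  rw [tsum_eq_single 0]
  · simp [cf]
  · intro m hm; simp [hm]

lemma besselJ_eq (ν : ℝ) {x : ℝ} (hx : 0 < x) : besselJ ν x = (x / 2) ^ ν * gs ν ((x / 2) ^ 2) := by
  unfold besselJ gs
  rw [← tsum_mul_left]
  congr 1
  ext m
  have : 0 < x / 2 := by positivity
  rw [Real.rpow_add this, show (2 * (m : ℝ)) = ((2 * m : ℕ) : ℝ) by push_cast; ring, Real.rpow_natCast, pow_mul]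
  unfold cf
  ring

lemma gs_cont (ν : ℝ) : Continuous (gs ν) :=
  continuous_iff_continuousAt.mpr (fun y => (gs_hasDerivAt ν y).continuousAt)

/-- three-term recurrence -/
lemma besselJ_rec (ν : ℝ) {x : ℝ} (hx : 0 < x) :
    besselJ (ν - 1) x + besselJ (ν + 1) x = 2 * ν / x * besselJ ν x := by
  have h2 : 0 < x / 2 := by positivity
  rw [besselJ_eq _ hx, besselJ_eq _ hx, besselJ_eq _ hx, gs_rec, Real.rpow_sub_one h2.ne', Real.rpow_add_one h2.ne']
  field_simp
  ring

lemma besselJ_hasDerivAt (ν : ℝ) {x : ℝ} (hx : 0 < x) :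
    HasDerivAt (besselJ ν) (ν / x * besselJ ν x - besselJ (ν + 1) x) x := by
  have h2 : 0 < x / 2 := by positivity
  have h1 : HasDerivAt (fun x : ℝ => x / 2) (1 / 2) x := (hasDerivAt_id x).div_const 2
  have h3 := h1.rpow_const (p := ν) (Or.inl h2.ne')
  have h4 : HasDerivAt (fun x : ℝ => gs ν ((x / 2) ^ 2)) (- gs (ν + 1) ((x / 2) ^ 2) * (x / 2)) x := by
    have := (gs_hasDerivAt ν ((x / 2) ^ 2)).comp x (h1.pow 2)
    refine this.congr_deriv ?_
    norm_num
    left; ring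
  have h5 := h3.mul h4
  have h6 : besselJ ν =ᶠ[𝓝 x] fun x => (x / 2) ^ ν * gs ν ((x / 2) ^ 2) := by
    filter_upwards [lt_mem_nhds hx] with y hy using besselJ_eq ν hy
  refine (h5.congr_of_eventuallyEq h6).congr_deriv ?_
  rw [besselJ_eq _ hx, besselJ_eq _ hx, Real.rpow_sub_one h2.ne', Real.rpow_add_one h2.ne']
  field_simp
  ring

lemma besselJ_lim (ν : ℝ) :
    Tendsto (fun x => (x / 2) ^ (-ν) * besselJ ν x) (𝓝[>] 0) (𝓝 (1 / Real.Gamma (ν + 1))) := by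
  have h : Tendsto (fun x : ℝ => gs ν ((x / 2) ^ 2)) (𝓝[>] 0) (𝓝 (1 / Real.Gamma (ν + 1))) := by
    rw [← gs_zero]
    have : Continuous (fun x : ℝ => gs ν ((x / 2) ^ 2)) := (gs_cont ν).comp (by fun_prop)
    have h0 := this.tendsto 0
    simp only [zero_div, ne_eq, OfNat.ofNat_ne_zero, not_false_eq_true, zero_pow] at h0
    exact h0.mono_left nhdsWithin_le_nhds
  refine h.congr' ?_
  filter_upwards [self_mem_nhdsWithin] with x hx
  have hx : 0 < x := hx
  have h2 : 0 < x / 2 := by positivity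
  rw [besselJ_eq _ hx, ← mul_assoc, ← Real.rpow_add h2]
  simp

end BD

namespace BD

open MeasureTheory

/-- `∫_0^∞ exp(-x sinh t - ν t) dt` -/
noncomputable def EE (ν x : ℝ) : ℝ := ∫ t in Ioi (0:ℝ), Real.exp (-x * Real.sinh t - ν * t)

lemma sinh_ge_sq {t : ℝ} (ht : 0 ≤ t) : t ^ 2 / 4 ≤ Real.sinh t := by
  have h1 := Real.quadratic_le_exp_of_nonneg ht
  have h2 : Real.exp (-t) ≤ 1 := Real.exp_le_one_iff.mpr (by linarith)
  rw [Real.sinh_eq]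
  nlinarith

lemma sinh_ge_self {t : ℝ} (ht : 0 ≤ t) : t ≤ Real.sinh t := Real.self_le_sinh_iff.mpr ht

lemma E_bound {δ x N ν t : ℝ} (hδ : 0 < δ) (hx : δ ≤ x) (hν : |ν| ≤ N) (ht : 0 ≤ t) :
    Real.exp (-x * Real.sinh t - ν * t) ≤ Real.exp ((N + 1) ^ 2 / δ) * Real.exp (-t) := by
  rw [← Real.exp_add]
  apply Real.exp_le_exp.mpr
  have h1 := sinh_ge_sq ht
  have h2 : δ * (t ^ 2 / 4) ≤ x * Real.sinh t := by
    apply mul_le_mul hx h1 (by positivity) (by linarith)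
  have h3 : -ν * t ≤ N * t := by
    apply mul_le_mul_of_nonneg_right _ ht
    linarith [neg_abs_le ν]
  have h4 : (N + 1) * t ≤ (N + 1) ^ 2 / δ + δ * (t ^ 2 / 4) := by
    have : (N + 1) ^ 2 / δ + δ * (t ^ 2 / 4) - (N + 1) * t = ((N + 1) - δ * t / 2) ^ 2 / δ := by
      field_simp; ring
    have h5 : 0 ≤ ((N + 1) - δ * t / 2) ^ 2 / δ := by positivity
    linarith
  linarith

lemma integrable_bd (C : ℝ) : IntegrableOn (fun t => C * Real.exp (-t)) (Ioi 0) := by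
  apply Integrable.const_mul
  exact integrableOn_exp_neg_Ioi 0

lemma E_meas (ν x : ℝ) : AEStronglyMeasurable (fun t => Real.exp (-x * Real.sinh t - ν * t)) (volume.restrict (Ioi (0:ℝ))) := by
  apply Continuous.aestronglyMeasurable
  have := Real.continuous_sinh
  fun_prop

lemma E_int (ν : ℝ) {x : ℝ} (hx : 0 < x) : IntegrableOn (fun t => Real.exp (-x * Real.sinh t - ν * t)) (Ioi 0) := by
  refine Integrable.mono' (integrable_bd (Real.exp ((|ν| + 1) ^ 2 / x))) (E_meas ν x) ?_
  filter_upwards [ae_restrict_mem measurableSet_Ioi] with t ht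
  rw [Real.norm_eq_abs, abs_of_pos (Real.exp_pos _)]
  exact E_bound hx le_rfl le_rfl (le_of_lt ht)

lemma sinh_mul_exp (ν x t : ℝ) : -Real.sinh t * Real.exp (-x * Real.sinh t - ν * t) =
    (1/2) * Real.exp (-x * Real.sinh t - (ν + 1) * t) - (1/2) * Real.exp (-x * Real.sinh t - (ν - 1) * t) := by
  rw [show -x * Real.sinh t - (ν + 1) * t = (-x * Real.sinh t - ν * t) + (-t) by ring,
    show -x * Real.sinh t - (ν - 1) * t = (-x * Real.sinh t - ν * t) + t by ring, Real.exp_add, Real.exp_add]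
  nth_rewrite 1 [Real.sinh_eq]
  ring

lemma cosh_mul_exp (ν x t : ℝ) : Real.cosh t * Real.exp (-x * Real.sinh t - ν * t) =
    (1/2) * Real.exp (-x * Real.sinh t - (ν + 1) * t) + (1/2) * Real.exp (-x * Real.sinh t - (ν - 1) * t) := by
  rw [show -x * Real.sinh t - (ν + 1) * t = (-x * Real.sinh t - ν * t) + (-t) by ring,
    show -x * Real.sinh t - (ν - 1) * t = (-x * Real.sinh t - ν * t) + t by ring, Real.exp_add, Real.exp_add]
  nth_rewrite 1 [Real.cosh_eq]
  ring

lemma E_hasDerivAt' (ν : ℝ) {x : ℝ} (hx : 0 < x) :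
    HasDerivAt (EE ν) (∫ t in Ioi (0:ℝ), -Real.sinh t * Real.exp (-x * Real.sinh t - ν * t)) x := by
  have hb : ∀ᵐ t ∂(volume.restrict (Ioi (0:ℝ))), ∀ y ∈ Ioi (x / 2),
      ‖-Real.sinh t * Real.exp (-y * Real.sinh t - ν * t)‖ ≤ Real.exp ((|ν| + 2) ^ 2 / (x / 2)) * Real.exp (-t) := by
    filter_upwards [ae_restrict_mem measurableSet_Ioi] with t ht y hy
    have ht : 0 < t := ht
    have hn : |ν + 1| ≤ |ν| + 1 := (abs_add_le _ _).trans (by simp)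
    have hn2 : |ν - 1| ≤ |ν| + 1 := (abs_sub _ _).trans (by simp)
    have b1 := E_bound (δ := x / 2) (by positivity) (le_of_lt hy) hn2 ht.le
    have p1 := Real.exp_pos (-y * Real.sinh t - (ν + 1) * t)
    have hs : 0 < Real.sinh t := Real.sinh_pos_iff.mpr ht
    have e := sinh_mul_exp ν y t
    rw [norm_mul, norm_neg, Real.norm_eq_abs, Real.norm_eq_abs, abs_of_pos hs, abs_of_pos (Real.exp_pos _)]
    rw [show |ν| + 1 + 1 = |ν| + 2 by ring] at b1
    have p2 := Real.exp_pos (-y * Real.sinh t - (ν - 1) * t)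
    linarith
  have := (hasDerivAt_integral_of_dominated_loc_of_deriv_le (μ := volume.restrict (Ioi (0:ℝ)))
    (F := fun y t => Real.exp (-y * Real.sinh t - ν * t))
    (F' := fun y t => -Real.sinh t * Real.exp (-y * Real.sinh t - ν * t)) (x₀ := x) (s := Ioi (x / 2))
    (bound := fun t => Real.exp ((|ν| + 2) ^ 2 / (x / 2)) * Real.exp (-t))
    (Ioi_mem_nhds (by linarith)) (Eventually.of_forall (fun y => E_meas ν y)) (E_int ν hx) ?_ hb (integrable_bd _) ?_).2
  · exact this
  · apply Continuous.aestronglyMeasurable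
    have := Real.continuous_sinh
    fun_prop
  · refine Eventually.of_forall (fun t y _ => ?_)
    have h1 : HasDerivAt (fun y : ℝ => -y * Real.sinh t - ν * t) (-Real.sinh t) y := by
      have := (((hasDerivAt_id y).neg).mul_const (Real.sinh t)).sub_const (ν * t)
      refine this.congr_deriv (by simp)
    refine h1.exp.congr_deriv (by ring)

lemma E_hasDerivAt (ν : ℝ) {x : ℝ} (hx : 0 < x) :
    HasDerivAt (EE ν) ((EE (ν + 1) x - EE (ν - 1) x) / 2) x := by
  refine (E_hasDerivAt' ν hx).congr_deriv ?_
  simp_rw [sinh_mul_exp]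
  rw [integral_sub ((E_int _ hx).const_mul _) ((E_int _ hx).const_mul _), integral_const_mul, integral_const_mul]
  unfold EE
  ring

lemma E_rec (ν : ℝ) {x : ℝ} (hx : 0 < x) :
    x / 2 * (EE (ν - 1) x + EE (ν + 1) x) + ν * EE ν x = 1 := by
  have hd : ∀ t ∈ Ioi (0:ℝ), HasDerivAt (fun t => Real.exp (-x * Real.sinh t - ν * t))
      ((-(x/2)) * Real.exp (-x * Real.sinh t - (ν + 1) * t) + (-(x/2)) * Real.exp (-x * Real.sinh t - (ν - 1) * t)
        + (-ν) * Real.exp (-x * Real.sinh t - ν * t)) t := by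
    intro t _
    have h1 : HasDerivAt (fun t : ℝ => -x * Real.sinh t - ν * t) (-x * Real.cosh t - ν) t := by
      have := ((Real.hasDerivAt_sinh t).const_mul (-x)).sub ((hasDerivAt_id t).const_mul ν)
      refine this.congr_deriv (by simp)
    refine h1.exp.congr_deriv ?_
    linear_combination (-x) * cosh_mul_exp ν x t
  have hi1 := (E_int (ν + 1) hx).const_mul (-(x/2))
  have hi2 := (E_int (ν - 1) hx).const_mul (-(x/2))
  have hi3 := (E_int ν hx).const_mul (-ν)
  have ht : Tendsto (fun t => Real.exp (-x * Real.sinh t - ν * t)) atTop (𝓝 0) := by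
    have h0 : Tendsto (fun t => Real.exp ((|ν| + 1) ^ 2 / x) * Real.exp (-t)) atTop (𝓝 0) := by
      have := (Real.tendsto_exp_neg_atTop_nhds_zero).const_mul (Real.exp ((|ν| + 1) ^ 2 / x))
      simpa using this
    refine squeeze_zero' (Eventually.of_forall (fun t => (Real.exp_pos _).le)) ?_ h0
    filter_upwards [eventually_ge_atTop 0] with t ht
    exact E_bound hx le_rfl le_rfl ht
  have := integral_Ioi_of_hasDerivAt_of_tendsto (a := 0)
    (f := fun t => Real.exp (-x * Real.sinh t - ν * t)) (m := 0)
    (by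
      apply Continuous.continuousWithinAt
      have := Real.continuous_sinh
      fun_prop) hd ((hi1.add hi2).add hi3) ht
  have hi12 : Integrable (fun t => (-(x/2)) * Real.exp (-x * Real.sinh t - (ν + 1) * t)
    + (-(x/2)) * Real.exp (-x * Real.sinh t - (ν - 1) * t)) (volume.restrict (Ioi (0:ℝ))) := hi1.add hi2
  rw [integral_add hi12 hi3, integral_add hi1 hi2, integral_const_mul, integral_const_mul,
    integral_const_mul] at this
  simp only [Real.sinh_zero, mul_zero, sub_zero, Real.exp_zero] at this
  unfold EE
  linarith

lemma E_cont (x : ℝ) (hx : 0 < x) : Continuous (fun ν => EE ν x) := by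
  rw [continuous_iff_continuousAt]
  intro ν
  refine continuousAt_of_dominated (bound := fun t => Real.exp ((|ν| + 1 + 1) ^ 2 / x) * Real.exp (-t))
    (Eventually.of_forall (fun y => E_meas y x)) ?_ (integrable_bd _) ?_
  · filter_upwards [Metric.ball_mem_nhds ν one_pos] with y hy
    filter_upwards [ae_restrict_mem measurableSet_Ioi] with t ht
    rw [Real.norm_eq_abs, abs_of_pos (Real.exp_pos _)]
    refine E_bound hx le_rfl ?_ (le_of_lt ht)
    rw [Metric.mem_ball, Real.dist_eq] at hy
    have := abs_add_le (y - ν) ν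
    rw [sub_add_cancel] at this
    linarith
  · refine Eventually.of_forall (fun t => ?_)
    apply Continuous.continuousAt
    fun_prop

lemma E_nonneg (ν x : ℝ) : 0 ≤ EE ν x := integral_nonneg (fun _ => (Real.exp_pos _).le)

lemma E_le_large (ν : ℝ) : ∃ C : ℝ, 0 ≤ C ∧ ∀ x, 1 ≤ x → EE ν x ≤ C / x := by
  refine ⟨Real.exp ((|ν| + 1) ^ 2 / 1), (Real.exp_pos _).le, fun x hx => ?_⟩
  have hx0 : 0 < x := by linarith
  have hi : IntegrableOn (fun t => Real.exp ((|ν| + 1) ^ 2 / 1) * Real.exp (-x * t)) (Ioi 0) := by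
    apply Integrable.const_mul
    exact exp_neg_integrableOn_Ioi 0 hx0
  have h1 : EE ν x ≤ ∫ t in Ioi (0:ℝ), Real.exp ((|ν| + 1) ^ 2 / 1) * Real.exp (-x * t) := by
    refine setIntegral_mono_on (E_int ν hx0) hi measurableSet_Ioi (fun t ht => ?_)
    have ht : 0 < t := ht
    have := E_bound (δ := 1) (x := 1) (ν := ν) one_pos le_rfl le_rfl ht.le
    calc Real.exp (-x * Real.sinh t - ν * t) = Real.exp (-(x-1) * Real.sinh t) * Real.exp (-1 * Real.sinh t - ν * t) := by
          rw [← Real.exp_add]; congr 1; ring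
      _ ≤ Real.exp (-(x-1) * t) * (Real.exp ((|ν| + 1) ^ 2 / 1) * Real.exp (-t)) := by
          gcongr ?_ * ?_
          apply Real.exp_le_exp.mpr
          nlinarith [sinh_ge_self ht.le]
      _ = _ := by
          rw [mul_left_comm, ← Real.exp_add]
          congr 2; ring
  rw [integral_const_mul, integral_exp_mul_Ioi (by linarith)] at h1
  simpa [div_eq_mul_inv] using h1

lemma E_le_small {ν x : ℝ} (hν : 0 < ν) (hx : 0 < x) : EE ν x ≤ 1 / ν := by
  have hi : IntegrableOn (fun t => Real.exp (-ν * t)) (Ioi 0) := exp_neg_integrableOn_Ioi 0 hν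
  have h1 : EE ν x ≤ ∫ t in Ioi (0:ℝ), Real.exp (-ν * t) := by
    refine setIntegral_mono_on (E_int ν hx) hi measurableSet_Ioi (fun t ht => ?_)
    have ht : 0 < t := ht
    apply Real.exp_le_exp.mpr
    nlinarith [Real.sinh_pos_iff.mpr ht]
  rw [integral_exp_mul_Ioi (by linarith)] at h1
  simpa using h1

lemma G_sub {a x : ℝ} (hx : 0 < x) :
    ∫ s in Ioi (x / 2), Real.exp (-s) * s ^ (a - 1) =
      (x / 2) ^ a * ∫ t in Ioi (0:ℝ), Real.exp (a * t - x / 2 * Real.exp t) := by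
  have h2 : 0 < x / 2 := by positivity
  have him : (fun t => x / 2 * Real.exp t) '' (Ioi 0) = Ioi (x / 2) := by
    ext s
    simp only [mem_image, mem_Ioi]
    constructor
    · rintro ⟨t, ht, rfl⟩
      have := Real.one_lt_exp_iff.mpr ht
      nlinarith
    · intro hs
      refine ⟨Real.log (s / (x / 2)), Real.log_pos ((one_lt_div h2).mpr hs), ?_⟩
      rw [Real.exp_log (div_pos (by linarith) h2)]
      field_simp
  have := integral_image_eq_integral_abs_deriv_smul (s := Ioi (0:ℝ)) (f := fun t => x / 2 * Real.exp t)
    (f' := fun t => x / 2 * Real.exp t) measurableSet_Ioi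
    (fun t _ => ((Real.hasDerivAt_exp t).const_mul _).hasDerivWithinAt)
    (fun t _ s _ h => by
      have h : x / 2 * Real.exp t = x / 2 * Real.exp s := h
      exact Real.exp_injective (mul_left_cancel₀ h2.ne' h))
    (fun s => Real.exp (-s) * s ^ (a - 1))
  rw [him] at this
  rw [this, ← integral_const_mul]
  refine setIntegral_congr_fun measurableSet_Ioi (fun t _ => ?_)
  have hp : 0 < x / 2 * Real.exp t := by positivity
  simp only [smul_eq_mul]
  rw [abs_of_pos hp, Real.rpow_sub_one hp.ne', Real.mul_rpow h2.le (Real.exp_pos t).le, ← Real.exp_mul,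
    sub_eq_add_neg, Real.exp_add]
  field_simp

lemma E_lim {a : ℝ} (ha : 0 < a) :
    Tendsto (fun x => (x / 2) ^ a * EE (-a) x) (𝓝[>] 0) (𝓝 (Real.Gamma a)) := by
  have hG : Tendsto (fun x : ℝ => ∫ s in Ioi (x / 2), Real.exp (-s) * s ^ (a - 1)) (𝓝[>] 0) (𝓝 (Real.Gamma a)) := by
    have hIntg := Real.GammaIntegral_convergent ha
    have hi2 : IntervalIntegrable (fun s => Real.exp (-s) * s ^ (a - 1)) volume 0 1 := by
      rw [intervalIntegrable_iff_integrableOn_Ioc_of_le zero_le_one]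
      exact hIntg.mono_set Ioc_subset_Ioi_self
    have e : ∀ᶠ x : ℝ in 𝓝[>] 0, Real.Gamma a - (∫ s in (0:ℝ)..(x / 2), Real.exp (-s) * s ^ (a - 1)) =
        ∫ s in Ioi (x / 2), Real.exp (-s) * s ^ (a - 1) := by
      filter_upwards [self_mem_nhdsWithin] with x hx
      have hx : 0 < x := hx
      rw [Real.Gamma_eq_integral ha, intervalIntegral.integral_of_le (by positivity : (0:ℝ) ≤ x / 2),
        ← Ioc_union_Ioi_eq_Ioi (by positivity : (0:ℝ) ≤ x / 2),
        setIntegral_union Ioc_disjoint_Ioi_same measurableSet_Ioi (hIntg.mono_set Ioc_subset_Ioi_self)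
          (hIntg.mono_set (Ioi_subset_Ioi (by positivity)))]
      ring
    refine Tendsto.congr' e ?_
    have hc : ContinuousOn (fun y => ∫ s in (0:ℝ)..y, Real.exp (-s) * s ^ (a - 1)) (Icc 0 1) := by
      have := intervalIntegral.continuousOn_primitive_interval' (a := 0) hi2 (by simp)
      rwa [uIcc_of_le zero_le_one] at this
    have h0 := hc 0 (by simp)
    have h1 : Tendsto (fun x : ℝ => x / 2) (𝓝[>] 0) (𝓝[Icc 0 1] 0) := by
      apply tendsto_nhdsWithin_of_tendsto_nhds_of_eventually_within
      · have : Tendsto (fun x : ℝ => x / 2) (𝓝 0) (𝓝 (0 / 2)) := tendsto_id.div_const 2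
        rw [zero_div] at this
        exact this.mono_left nhdsWithin_le_nhds
      · filter_upwards [Ioo_mem_nhdsGT (show (0:ℝ) < 1 by norm_num)] with x hx
        constructor <;> linarith [hx.1, hx.2]
    have h2 := h0.tendsto.comp h1
    have h3 := h2.const_sub (Real.Gamma a)
    simpa using h3
  have hup : Tendsto (fun x : ℝ => Real.exp (x / 2) * ∫ s in Ioi (x / 2), Real.exp (-s) * s ^ (a - 1)) (𝓝[>] 0) (𝓝 (Real.Gamma a)) := by
    have h1 : Tendsto (fun x : ℝ => Real.exp (x / 2)) (𝓝[>] 0) (𝓝 1) := by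
      have : Continuous (fun x : ℝ => Real.exp (x / 2)) := by fun_prop
      have h := this.tendsto 0
      simp only [zero_div, Real.exp_zero] at h
      exact h.mono_left nhdsWithin_le_nhds
    simpa using h1.mul hG
  have hIntg : ∀ x : ℝ, 0 < x → IntegrableOn (fun t => Real.exp (a * t - x / 2 * Real.exp t)) (Ioi 0) := by
    intro x hx
    refine Integrable.mono' (E_int (-a) hx) ?_ ?_
    · apply Continuous.aestronglyMeasurable; fun_prop
    · filter_upwards with t
      rw [Real.norm_eq_abs, abs_of_pos (Real.exp_pos _)]
      apply Real.exp_le_exp.mpr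
      rw [Real.sinh_eq]
      nlinarith [Real.exp_pos (-t)]
  refine tendsto_of_tendsto_of_tendsto_of_le_of_le' hG hup ?_ ?_
  · filter_upwards [self_mem_nhdsWithin] with x hx
    have hx : 0 < x := hx
    rw [G_sub hx]
    gcongr
    refine setIntegral_mono_on (hIntg x hx) (E_int _ hx) measurableSet_Ioi (fun t ht => ?_)
    apply Real.exp_le_exp.mpr
    rw [Real.sinh_eq]
    nlinarith [Real.exp_pos (-t)]
  · filter_upwards [self_mem_nhdsWithin] with x hx
    have hx : 0 < x := hx
    rw [G_sub hx, mul_left_comm]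
    gcongr
    rw [← integral_const_mul]
    refine setIntegral_mono_on (E_int _ hx) ((hIntg x hx).const_mul _) measurableSet_Ioi (fun t ht => ?_)
    have ht : 0 < t := ht
    rw [← Real.exp_add]
    apply Real.exp_le_exp.mpr
    rw [Real.sinh_eq]
    have : Real.exp (-t) ≤ 1 := Real.exp_le_one_iff.mpr (by linarith)
    nlinarith

end BD

namespace BD

open MeasureTheory

noncomputable def ker (ν x θ : ℝ) : ℂ := Complex.exp (Complex.I * ((x * Real.sin θ - ν * θ : ℝ) : ℂ))

noncomputable def Hc (ν x : ℝ) : ℂ := ∫ θ in (0:ℝ)..π, ker ν x θ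

noncomputable def ph (s : ℝ) : ℂ := Complex.exp (-(Complex.I * (s : ℂ)))

lemma ph_add (s t : ℝ) : ph (s + t) = ph s * ph t := by
  unfold ph; rw [← Complex.exp_add]; congr 1; push_cast; ring

lemma ph_pi : ph π = -1 := by
  unfold ph
  rw [Complex.exp_neg, mul_comm, Complex.exp_pi_mul_I]; norm_num

lemma ph_neg_pi : ph (-π) = -1 := by
  unfold ph
  rw [mul_comm]; push_cast; rw [neg_mul, neg_neg, Complex.exp_pi_mul_I]

lemma ph_norm (s : ℝ) : ‖ph s‖ = 1 := by
  unfold ph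
  rw [show -(Complex.I * (s:ℂ)) = ((-s : ℝ) : ℂ) * Complex.I by push_cast; ring]
  exact Complex.norm_exp_ofReal_mul_I _

lemma ph_re (s : ℝ) : (ph s).re = Real.cos s := by
  unfold ph
  rw [show -(Complex.I * (s:ℂ)) = ((-s : ℝ) : ℂ) * Complex.I by push_cast; ring, Complex.exp_ofReal_mul_I_re, Real.cos_neg]

lemma ph_im (s : ℝ) : (ph s).im = - Real.sin s := by
  unfold ph
  rw [show -(Complex.I * (s:ℂ)) = ((-s : ℝ) : ℂ) * Complex.I by push_cast; ring, Complex.exp_ofReal_mul_I_im, Real.sin_neg]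

lemma ker_cont (ν x : ℝ) : Continuous (ker ν x) := by
  unfold ker; fun_prop

lemma ker_norm (ν x θ : ℝ) : ‖ker ν x θ‖ = 1 := by
  unfold ker
  rw [mul_comm]
  exact Complex.norm_exp_ofReal_mul_I _

lemma ker_int (ν x : ℝ) : IntervalIntegrable (ker ν x) volume 0 π := (ker_cont ν x).intervalIntegrable _ _

lemma ker_shift (ν x θ s : ℝ) : ker (ν + s) x θ = ker ν x θ * ph (s * θ) := by
  unfold ker ph
  rw [← Complex.exp_add]; congr 1; push_cast; ring

lemma ph_sub_sin (θ : ℝ) : Complex.I * (Real.sin θ : ℂ) = (ph (-1 * θ) - ph (1 * θ)) / 2 := by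
  have h : ph (-1 * θ) - ph (1 * θ) = 2 * (Complex.I * (Real.sin θ : ℂ)) := by
    apply Complex.ext
    · simp only [Complex.sub_re, ph_re, Complex.mul_re, Complex.mul_im, Complex.I_re, Complex.I_im,
        Complex.ofReal_re, Complex.ofReal_im, Complex.re_ofNat, Complex.im_ofNat]
      rw [one_mul, neg_one_mul, Real.cos_neg]; ring
    · simp only [Complex.sub_im, ph_im, Complex.mul_re, Complex.mul_im, Complex.I_re, Complex.I_im,
        Complex.ofReal_re, Complex.ofReal_im, Complex.re_ofNat, Complex.im_ofNat]
      rw [one_mul, neg_one_mul, Real.sin_neg]; ring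
  rw [h]; ring

lemma ph_add_cos (θ : ℝ) : (Real.cos θ : ℂ) = (ph (-1 * θ) + ph (1 * θ)) / 2 := by
  apply Complex.ext
  · simp [ph_re, ph_im, Complex.cos_ofReal_re]
  · simp [ph_re, ph_im, Complex.cos_ofReal_im]

lemma ker_sin (ν x θ : ℝ) : Complex.I * (Real.sin θ : ℂ) * ker ν x θ = (1 / 2) * ker (ν - 1) x θ - (1 / 2) * ker (ν + 1) x θ := by
  rw [sub_eq_add_neg ν 1, ker_shift, ker_shift, ph_sub_sin]; ring

lemma ker_cos (ν x θ : ℝ) : (Real.cos θ : ℂ) * ker ν x θ = (1 / 2) * ker (ν - 1) x θ + (1 / 2) * ker (ν + 1) x θ := by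
  rw [sub_eq_add_neg ν 1, ker_shift, ker_shift, ph_add_cos]; ring

lemma ker_hasDerivAt_x (ν x θ : ℝ) : HasDerivAt (fun x => ker ν x θ) (Complex.I * (Real.sin θ : ℂ) * ker ν x θ) x := by
  have h1 : HasDerivAt (fun x : ℝ => x * Real.sin θ - ν * θ) (Real.sin θ) x := by
    simpa using ((hasDerivAt_id x).mul_const (Real.sin θ)).sub_const (ν * θ)
  have h2 := (h1.ofReal_comp.const_mul Complex.I).cexp
  refine h2.congr_deriv ?_
  unfold ker; ring

lemma ker_hasDerivAt_t (ν x θ : ℝ) : HasDerivAt (ker ν x) (Complex.I * (x * Real.cos θ - ν) * ker ν x θ) θ := by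
  have h1 : HasDerivAt (fun θ : ℝ => x * Real.sin θ - ν * θ) (x * Real.cos θ - ν) θ := by
    exact (((Real.hasDerivAt_sin θ).const_mul x).sub ((hasDerivAt_id θ).const_mul ν)).congr_deriv (by simp)
  have h2 := (h1.ofReal_comp.const_mul Complex.I).cexp
  refine h2.congr_deriv ?_
  unfold ker; push_cast; ring

lemma Hc_hasDerivAt' (ν x : ℝ) : HasDerivAt (Hc ν) (∫ θ in (0:ℝ)..π, Complex.I * (Real.sin θ : ℂ) * ker ν x θ) x := by
  refine (intervalIntegral.hasDerivAt_integral_of_dominated_loc_of_deriv_le (μ := volume) (F := fun x θ => ker ν x θ)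
    (F' := fun x θ => Complex.I * (Real.sin θ : ℂ) * ker ν x θ) (s := univ) (bound := fun _ => 1)
    univ_mem ?_ (ker_int ν x) ?_ ?_ ?_ ?_).2
  · exact Eventually.of_forall (fun y => (ker_cont ν y).aestronglyMeasurable)
  · apply Continuous.aestronglyMeasurable
    have := ker_cont ν x
    fun_prop
  · refine Eventually.of_forall (fun t _ y _ => ?_)
    rw [norm_mul, norm_mul, ker_norm, Complex.norm_I, Complex.norm_real, one_mul, mul_one]
    exact Real.abs_sin_le_one t
  · exact intervalIntegrable_const
  · exact Eventually.of_forall (fun t _ y _ => ker_hasDerivAt_x ν y t)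

lemma Hc_hasDerivAt (ν x : ℝ) : HasDerivAt (Hc ν) ((Hc (ν - 1) x - Hc (ν + 1) x) / 2) x := by
  refine (Hc_hasDerivAt' ν x).congr_deriv ?_
  simp_rw [ker_sin]
  rw [intervalIntegral.integral_sub ((ker_int _ _).const_mul _) ((ker_int _ _).const_mul _),
    intervalIntegral.integral_const_mul, intervalIntegral.integral_const_mul]
  unfold Hc
  ring

lemma Hc_rec (ν x : ℝ) : (x / 2 : ℂ) * (Hc (ν - 1) x + Hc (ν + 1) x) - ν * Hc ν x = Complex.I * (1 - ph (ν * π)) := by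
  have hi1 : IntervalIntegrable (fun θ => (Complex.I * x / 2) * ker (ν - 1) x θ) volume 0 π := (ker_int _ _).const_mul _
  have hi2 : IntervalIntegrable (fun θ => (Complex.I * x / 2) * ker (ν + 1) x θ) volume 0 π := (ker_int _ _).const_mul _
  have hi3 : IntervalIntegrable (fun θ => (Complex.I * ν) * ker ν x θ) volume 0 π := (ker_int _ _).const_mul _
  have h := intervalIntegral.integral_eq_sub_of_hasDerivAt (a := 0) (b := π) (f := ker ν x)
    (f' := fun θ => (Complex.I * x / 2) * ker (ν - 1) x θ + (Complex.I * x / 2) * ker (ν + 1) x θ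
      - (Complex.I * ν) * ker ν x θ)
    (fun θ _ => by
      refine (ker_hasDerivAt_t ν x θ).congr_deriv ?_
      linear_combination (Complex.I * x) * ker_cos ν x θ) ((hi1.add hi2).sub hi3)
  rw [intervalIntegral.integral_sub (hi1.add hi2) hi3, intervalIntegral.integral_add hi1 hi2,
    intervalIntegral.integral_const_mul, intervalIntegral.integral_const_mul, intervalIntegral.integral_const_mul] at h
  have e1 : ker ν x π = ph (ν * π) := by unfold ker ph; simp
  have e0 : ker ν x 0 = 1 := by unfold ker; simp
  rw [e1, e0] at h
  unfold Hc
  linear_combination (-Complex.I) * h + (x / 2 * ((∫ θ in (0:ℝ)..π, ker (ν - 1) x θ) + ∫ θ in (0:ℝ)..π, ker (ν + 1) x θ)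
    - ν * (∫ θ in (0:ℝ)..π, ker ν x θ)) * Complex.I_mul_I

lemma Hc_neg (ν x : ℝ) : Hc (-ν) x = ph (-ν * π) * Hc ν x := by
  unfold Hc
  rw [← intervalIntegral.integral_const_mul]
  have := intervalIntegral.integral_comp_sub_left (a := 0) (b := π) (fun θ => ker (-ν) x θ) π
  simp only [sub_self, sub_zero] at this
  rw [← this]
  congr 1
  ext θ
  unfold ker ph
  rw [← Complex.exp_add, Real.sin_pi_sub]
  congr 1; push_cast; ring

lemma Hc_cont (x : ℝ) : Continuous (fun ν => Hc ν x) := by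
  unfold Hc
  apply intervalIntegral.continuous_parametric_intervalIntegral_of_continuous'
  unfold ker Function.uncurry
  fun_prop

lemma Hc_norm (ν x : ℝ) : ‖Hc ν x‖ ≤ π := by
  have := intervalIntegral.norm_integral_le_of_norm_le_const (a := 0) (b := π) (f := ker ν x) (C := 1)
    (fun θ _ => (ker_norm ν x θ).le)
  simpa [Hc, abs_of_pos Real.pi_pos] using this

noncomputable def HH (ν x : ℝ) : ℂ :=
  (1 / π : ℂ) * (Hc ν x - Complex.I * (EE (-ν) x + ph (ν * π) * EE ν x))

lemma HH_neg (ν x : ℝ) : HH (-ν) x = ph (-ν * π) * HH ν x := by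
  unfold HH
  rw [Hc_neg, neg_neg]
  have : ph (-ν * π) * ph (ν * π) = 1 := by
    rw [← ph_add]; unfold ph; simp
  linear_combination (-(1 / π : ℂ) * Complex.I * EE ν x) * (-this)

lemma HH_cont (x : ℝ) (hx : 0 < x) : Continuous (fun ν => HH ν x) := by
  unfold HH
  have h1 := Hc_cont x
  have h2 := E_cont x hx
  have h3 : Continuous (fun ν => EE (-ν) x) := h2.comp continuous_neg
  unfold ph
  fun_prop

lemma ph_shift (ν : ℝ) : ph ((ν + 1) * π) = - ph (ν * π) := by
  rw [add_mul, ph_add, one_mul, ph_pi]; ring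

lemma ph_shift' (ν : ℝ) : ph ((ν - 1) * π) = - ph (ν * π) := by
  have := ph_shift (ν - 1)
  rw [sub_add_cancel] at this
  rw [this]; ring

lemma HH_deriv0 (ν : ℝ) {x : ℝ} (hx : 0 < x) : HasDerivAt (HH ν) ((HH (ν - 1) x - HH (ν + 1) x) / 2) x := by
  have h1 := Hc_hasDerivAt ν x
  have h2 := (E_hasDerivAt ν hx).ofReal_comp
  have h3 := (E_hasDerivAt (-ν) hx).ofReal_comp
  have h4 := (h1.sub ((h3.add (h2.const_mul (ph (ν * π)))).const_mul Complex.I)).const_mul (1 / π : ℂ)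
  refine h4.congr_deriv ?_
  unfold HH
  rw [ph_shift, ph_shift']
  rw [show -(ν - 1) = -ν + 1 by ring, show -(ν + 1) = -ν - 1 by ring]
  push_cast
  ring

lemma HH_rec (ν : ℝ) {x : ℝ} (hx : 0 < x) : HH (ν - 1) x + HH (ν + 1) x = 2 * ν / x * HH ν x := by
  have h1 := Hc_rec ν x
  have h2 : ((x / 2 * (EE (ν - 1) x + EE (ν + 1) x) + ν * EE ν x : ℝ) : ℂ) = 1 := by
    rw [E_rec ν hx]; norm_num
  have h3 : ((x / 2 * (EE (-ν - 1) x + EE (-ν + 1) x) + -ν * EE (-ν) x : ℝ) : ℂ) = 1 := by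
    rw [E_rec (-ν) hx]; norm_num
  have hx' : (x : ℂ) ≠ 0 := by exact_mod_cast hx.ne'
  push_cast at h2 h3
  have key : (x / 2 : ℂ) * (HH (ν - 1) x + HH (ν + 1) x) - ν * HH ν x = 0 := by
    unfold HH
    rw [ph_shift, ph_shift']
    rw [show -(ν - 1) = -ν + 1 by ring, show -(ν + 1) = -ν - 1 by ring]
    linear_combination (1 / π : ℂ) * h1 - (1 / π : ℂ) * Complex.I * h3 + (1 / π : ℂ) * Complex.I * ph (ν * π) * h2
  have hE : HH (ν - 1) x + HH (ν + 1) x = (2 / x : ℂ) * ((x / 2 : ℂ) * (HH (ν - 1) x + HH (ν + 1) x)) := by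
    field_simp
  rw [hE, sub_eq_zero.mp key]
  ring

lemma HH_hasDerivAt (ν : ℝ) {x : ℝ} (hx : 0 < x) : HasDerivAt (HH ν) (ν / x * HH ν x - HH (ν + 1) x) x := by
  refine (HH_deriv0 ν hx).congr_deriv ?_
  linear_combination (1 / 2 : ℂ) * HH_rec ν hx

noncomputable def KK (ν x : ℝ) : ℝ := (HH ν x).re
noncomputable def YY (ν x : ℝ) : ℝ := (HH ν x).im

lemma KK_rec (ν : ℝ) {x : ℝ} (hx : 0 < x) : KK (ν - 1) x + KK (ν + 1) x = 2 * ν / x * KK ν x := by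
  have := congrArg Complex.re (HH_rec ν hx)
  rw [show (2 * ν / x : ℂ) = ((2 * ν / x : ℝ) : ℂ) by push_cast; ring, Complex.re_ofReal_mul] at this
  exact this

lemma YY_rec (ν : ℝ) {x : ℝ} (hx : 0 < x) : YY (ν - 1) x + YY (ν + 1) x = 2 * ν / x * YY ν x := by
  have := congrArg Complex.im (HH_rec ν hx)
  rw [show (2 * ν / x : ℂ) = ((2 * ν / x : ℝ) : ℂ) by push_cast; ring, Complex.im_ofReal_mul] at this
  exact this

lemma KK_hasDerivAt (ν : ℝ) {x : ℝ} (hx : 0 < x) : HasDerivAt (KK ν) (ν / x * KK ν x - KK (ν + 1) x) x := by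
  have := Complex.reCLM.hasFDerivAt.comp_hasDerivAt x (HH_hasDerivAt ν hx)
  refine this.congr_deriv ?_
  rw [show (ν / x : ℂ) = ((ν / x : ℝ) : ℂ) by push_cast; ring]
  simp [KK, Complex.re_ofReal_mul, -Complex.ofReal_div]

lemma YY_hasDerivAt (ν : ℝ) {x : ℝ} (hx : 0 < x) : HasDerivAt (YY ν) (ν / x * YY ν x - YY (ν + 1) x) x := by
  have := Complex.imCLM.hasFDerivAt.comp_hasDerivAt x (HH_hasDerivAt ν hx)
  refine this.congr_deriv ?_
  rw [show (ν / x : ℂ) = ((ν / x : ℝ) : ℂ) by push_cast; ring]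
  simp [YY, Complex.im_ofReal_mul, -Complex.ofReal_div]

lemma KK_neg (ν x : ℝ) : KK (-ν) x = Real.cos (ν * π) * KK ν x - Real.sin (ν * π) * YY ν x := by
  unfold KK YY
  rw [HH_neg, Complex.mul_re, ph_re, ph_im, neg_mul, Real.cos_neg, Real.sin_neg]
  ring

lemma KK_eq (ν x : ℝ) : KK ν x = (1 / π) * ((Hc ν x).re - Real.sin (ν * π) * EE ν x) := by
  unfold KK HH
  rw [show (1 / π : ℂ) = ((1 / π : ℝ) : ℂ) by push_cast; ring, Complex.re_ofReal_mul]
  congr 1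
  simp [ph_im]
  
lemma YY_eq (ν x : ℝ) : YY ν x = (1 / π) * ((Hc ν x).im - EE (-ν) x - Real.cos (ν * π) * EE ν x) := by
  unfold YY HH
  rw [show (1 / π : ℂ) = ((1 / π : ℝ) : ℂ) by push_cast; ring, Complex.im_ofReal_mul]
  congr 1
  simp [ph_re]
  ring

end BD

namespace BD

open MeasureTheory

structure Cyl (F : ℝ → ℝ → ℝ) : Prop where
  der : ∀ ν x : ℝ, 0 < x → HasDerivAt (F ν) (ν / x * F ν x - F (ν + 1) x) x
  recr : ∀ ν x : ℝ, 0 < x → F (ν - 1) x + F (ν + 1) x = 2 * ν / x * F ν x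

lemma cylJ : Cyl besselJ := ⟨fun ν _ hx => besselJ_hasDerivAt ν hx, fun ν _ hx => besselJ_rec ν hx⟩
lemma cylK : Cyl KK := ⟨fun ν _ hx => KK_hasDerivAt ν hx, fun ν _ hx => KK_rec ν hx⟩
lemma cylY : Cyl YY := ⟨fun ν _ hx => YY_hasDerivAt ν hx, fun ν _ hx => YY_rec ν hx⟩

lemma Cyl.der' {F : ℝ → ℝ → ℝ} (h : Cyl F) (ν x : ℝ) (hx : 0 < x) :
    HasDerivAt (F (ν + 1)) (F ν x - (ν + 1) / x * F (ν + 1) x) x := by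
  convert h.der (ν + 1) x hx using 1
  have := h.recr (ν + 1) x hx
  rw [add_sub_cancel_right] at this
  have e : F (ν + 1 + 1) x = 2 * (ν + 1) / x * F (ν + 1) x - F ν x := by linarith
  rw [e]; ring

lemma const_of_deriv {f : ℝ → ℝ} (h : ∀ x, 0 < x → HasDerivAt f 0 x) :
    ∃ c, ∀ x, 0 < x → f x = c := by
  refine ⟨f 1, fun x hx => ?_⟩
  refine IsOpen.is_const_of_deriv_eq_zero (s := Ioi (0:ℝ)) isOpen_Ioi isPreconnected_Ioi
    (fun y hy => (h y hy).differentiableAt.differentiableWithinAt) (fun y hy => (h y hy).deriv) hx ?_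
  exact mem_Ioi.mpr one_pos

lemma cyl_wr {F G : ℝ → ℝ → ℝ} (hF : Cyl F) (hG : Cyl G) (ν : ℝ) :
    ∃ c, ∀ x, 0 < x → x * (F (ν + 1) x * G ν x - F ν x * G (ν + 1) x) = c := by
  apply const_of_deriv
  intro x hx
  have h := (hasDerivAt_id x).mul (((hF.der' ν x hx).mul (hG.der ν x hx)).sub
    ((hF.der ν x hx).mul (hG.der' ν x hx)))
  refine HasDerivAt.congr_deriv (h.congr_of_eventuallyEq (Eventually.of_forall fun y => rfl)) ?_
  simp only [id, Pi.mul_apply, Pi.sub_apply]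
  field_simp
  ring

lemma tends_half : Tendsto (fun x : ℝ => x / 2) (𝓝[>] 0) (𝓝 0) := by
  have : Tendsto (fun x : ℝ => x / 2) (𝓝 0) (𝓝 (0/2)) := (continuous_id.div_const 2).tendsto 0
  simpa using this.mono_left nhdsWithin_le_nhds

lemma tends_pow {a : ℝ} (ha : 0 < a) : Tendsto (fun x : ℝ => (x / 2) ^ a) (𝓝[>] 0) (𝓝 0) := by
  have := tends_half.rpow_const (p := a) (Or.inr ha.le)
  rwa [Real.zero_rpow ha.ne'] at this

lemma tends_pow_mul {a C : ℝ} (ha : 0 < a) {f : ℝ → ℝ} (hf : ∀ x, 0 < x → |f x| ≤ C) :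
    Tendsto (fun x : ℝ => (x / 2) ^ a * f x) (𝓝[>] 0) (𝓝 0) := by
  have h1 : Tendsto (fun x : ℝ => (x / 2) ^ a * C) (𝓝[>] 0) (𝓝 0) := by
    simpa using (tends_pow ha).mul_const C
  refine squeeze_zero_norm' ?_ h1
  filter_upwards [self_mem_nhdsWithin] with x hx
  have hx : 0 < x := hx
  have : 0 < (x / 2) ^ a := Real.rpow_pos_of_pos (by positivity) _
  rw [norm_mul, Real.norm_of_nonneg this.le]
  exact mul_le_mul_of_nonneg_left (hf x hx) this.le

lemma Hre (ν x : ℝ) : |(Hc ν x).re| ≤ π := (Complex.abs_re_le_norm _).trans (Hc_norm ν x)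
lemma Him (ν x : ℝ) : |(Hc ν x).im| ≤ π := (Complex.abs_im_le_norm _).trans (Hc_norm ν x)

lemma trig_E {ν x c : ℝ} (hν : 0 < ν) (hx : 0 < x) (hc : |c| ≤ 1) : |c * EE ν x| ≤ 1 / ν := by
  rw [abs_mul, abs_of_nonneg (E_nonneg ν x)]
  have := E_le_small hν hx
  have := E_nonneg ν x
  nlinarith

lemma KK_bdd {ν x : ℝ} (hν : 0 < ν) (hx : 0 < x) : |KK ν x| ≤ 1 / π * (π + 1 / ν) := by
  rw [KK_eq, abs_mul, abs_of_pos (by positivity : 0 < 1 / π)]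
  refine mul_le_mul_of_nonneg_left ?_ (by positivity)
  refine (abs_sub _ _).trans (add_le_add (Hre ν x) (trig_E hν hx (Real.abs_sin_le_one _)))

lemma YY_lim {ν : ℝ} (hν : 0 < ν) :
    Tendsto (fun x => (x / 2) ^ ν * YY ν x) (𝓝[>] 0) (𝓝 (-(Real.Gamma ν / π))) := by
  have h1 : Tendsto (fun x : ℝ => (x / 2) ^ ν * ((Hc ν x).im - Real.cos (ν * π) * EE ν x)) (𝓝[>] 0) (𝓝 0) :=
    tends_pow_mul (C := π + 1 / ν) hν (fun x hx =>
      (abs_sub _ _).trans (add_le_add (Him ν x) (trig_E hν hx (Real.abs_cos_le_one _))))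
  have h2 := (h1.sub (E_lim hν)).const_mul (1 / π)
  refine (h2.congr' ?_).trans (by apply le_of_eq; congr 1; ring)
  filter_upwards with x
  rw [YY_eq]; ring

lemma JY_wr {ν : ℝ} (hν : 0 < ν) {x : ℝ} (hx : 0 < x) :
    x * (besselJ (ν + 1) x * YY ν x - besselJ ν x * YY (ν + 1) x) = 2 / π := by
  obtain ⟨c, hc⟩ := cyl_wr cylJ cylY ν
  rw [hc x hx]
  have l1 : Tendsto (fun x : ℝ => 2 * (x / 2) ^ (2:ℝ) * (((x / 2) ^ (-(ν+1)) * besselJ (ν + 1) x) * ((x/2)^ν * YY ν x))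
      - 2 * (((x / 2) ^ (-ν) * besselJ ν x) * ((x/2)^(ν+1) * YY (ν+1) x))) (𝓝[>] 0)
      (𝓝 (2 * 0 * ((1 / Real.Gamma (ν + 1 + 1)) * (-(Real.Gamma ν / π))) - 2 * ((1 / Real.Gamma (ν + 1)) * (-(Real.Gamma (ν+1) / π))))) :=
    ((((tends_pow two_pos).const_mul 2)).mul ((besselJ_lim (ν+1)).mul (YY_lim hν))).sub
      (((besselJ_lim ν).mul (YY_lim (by linarith : 0 < ν + 1))).const_mul 2)
  have hG : Real.Gamma (ν + 1) ≠ 0 := (Real.Gamma_pos_of_pos (by linarith)).ne'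
  have e : (2 * 0 * ((1 / Real.Gamma (ν + 1 + 1)) * (-(Real.Gamma ν / π))) - 2 * ((1 / Real.Gamma (ν + 1)) * (-(Real.Gamma (ν+1) / π)))) = 2 / π := by
    field_simp; ring
  rw [e] at l1
  refine tendsto_nhds_unique (l := 𝓝[>] (0:ℝ)) ?_ l1
  refine (tendsto_const_nhds (x := c)).congr' ?_
  filter_upwards [self_mem_nhdsWithin] with y hy
  have hy : 0 < y := hy
  have hh : 0 < y / 2 := by positivity
  rw [← hc y hy]
  have a1 : (y/2)^(-(ν+1)) = ((y/2)^ν)⁻¹ * (y/2)⁻¹ := by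
    rw [Real.rpow_neg hh.le, Real.rpow_add hh, Real.rpow_one, mul_inv]
  have a2 : (y/2)^(-ν) = ((y/2)^ν)⁻¹ := by rw [Real.rpow_neg hh.le]
  have a3 : (y/2)^(ν+1) = ((y/2)^ν) * (y/2) := by
    rw [Real.rpow_add hh, Real.rpow_one]
  have a4 : (y/2)^(2:ℝ) = (y/2)^2 := by exact_mod_cast Real.rpow_natCast (y/2) 2
  rw [a1, a2, a3, a4]
  have : (y/2)^ν ≠ 0 := (Real.rpow_pos_of_pos hh _).ne'
  field_simp

lemma KJ_wr {ν : ℝ} (hν : 0 < ν) {x : ℝ} (hx : 0 < x) :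
    x * (KK (ν + 1) x * besselJ ν x - KK ν x * besselJ (ν + 1) x) = 0 := by
  obtain ⟨c, hc⟩ := cyl_wr cylK cylJ ν
  rw [hc x hx]
  have l1 : Tendsto (fun x : ℝ => 2 * ((x / 2) ^ (ν + 1) * KK (ν+1) x * ((x/2)^(-ν) * besselJ ν x) -
      (x / 2) ^ (ν + 2) * KK ν x * ((x/2)^(-(ν+1)) * besselJ (ν+1) x))) (𝓝[>] 0) 
      (𝓝 (2 * (0 * (1 / Real.Gamma (ν + 1)) - 0 * (1 / Real.Gamma (ν + 1 + 1))))) :=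
    (((tends_pow_mul (by linarith) (fun x hx => KK_bdd (by linarith) hx)).mul (besselJ_lim ν)).sub
      ((tends_pow_mul (by linarith) (fun x hx => KK_bdd (by linarith) hx)).mul (besselJ_lim (ν+1)))).const_mul 2
  simp only [zero_mul, sub_zero, mul_zero] at l1
  refine tendsto_nhds_unique (l := 𝓝[>] (0:ℝ)) ?_ l1
  refine (tendsto_const_nhds (x := c)).congr' ?_
  filter_upwards [self_mem_nhdsWithin] with y hy
  have hy : 0 < y := hy
  have hh : 0 < y / 2 := by positivity
  rw [← hc y hy]
  have a1 : (y/2)^(-(ν+1)) = ((y/2)^ν)⁻¹ * (y/2)⁻¹ := by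
    rw [Real.rpow_neg hh.le, Real.rpow_add hh, Real.rpow_one, mul_inv]
  have a2 : (y/2)^(-ν) = ((y/2)^ν)⁻¹ := by rw [Real.rpow_neg hh.le]
  have a3 : (y/2)^(ν+1) = ((y/2)^ν) * (y/2) := by
    rw [Real.rpow_add hh, Real.rpow_one]
  have a4 : (y/2)^(ν+2) = ((y/2)^ν) * (y/2)^2 := by
    rw [Real.rpow_add hh]; congr 1; exact_mod_cast Real.rpow_natCast (y/2) 2
  rw [a1, a2, a3, a4]
  have : (y/2)^ν ≠ 0 := (Real.rpow_pos_of_pos hh _).ne'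
  field_simp

lemma K_prop {ν : ℝ} (hν : 0 < ν) : ∃ α : ℝ, ∀ x, 0 < x →
    KK ν x = α * besselJ ν x ∧ KK (ν + 1) x = α * besselJ (ν + 1) x ∧
    KK (ν - 1) x = α * besselJ (ν - 1) x := by
  obtain ⟨c, hc⟩ := cyl_wr cylK cylY ν
  refine ⟨c * π / 2, fun x hx => ?_⟩
  have w1 := KJ_wr hν hx
  have w2 := JY_wr hν hx
  have w3 := hc x hx
  have hp := Real.pi_pos
  have hp' : π * (2 / π) = 2 := by field_simp
  have k0 : KK ν x = c * π / 2 * besselJ ν x := by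
    linear_combination (-(1/2)*π * KK ν x) * w2 + (1/2*π*besselJ ν x) * w3 - (1/2*π*YY ν x) * w1 - (1/2*KK ν x) * hp'
  have k1 : KK (ν+1) x = c * π / 2 * besselJ (ν+1) x := by
    linear_combination (-(1/2)*π * KK (ν+1) x) * w2 + (1/2*π*besselJ (ν+1) x) * w3 - (1/2*π*YY (ν+1) x) * w1 - (1/2*KK (ν+1) x) * hp'
  refine ⟨k0, k1, ?_⟩
  have r1 := KK_rec ν hx
  have r2 := besselJ_rec ν hx
  linear_combination r1 - (c*π/2) * r2 + (2 * ν / x) * k0 - k1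

lemma Hc_contx (ν : ℝ) : Continuous (Hc ν) :=
  continuous_iff_continuousAt.mpr fun x => (Hc_hasDerivAt ν x).continuousAt

lemma Hc00 : Hc 0 0 = π := by
  unfold Hc ker
  simp

lemma KK_lim {a : ℝ} (ha : -1 < a) (ha0 : a ≤ 0) :
    Tendsto (fun x => (x / 2) ^ (-a) * KK a x) (𝓝[>] 0) (𝓝 (1 / Real.Gamma (a + 1))) := by
  rcases ha0.eq_or_lt with rfl | h
  · have h1 : Tendsto (fun x => (1/π) * (Hc 0 x).re) (𝓝[>] 0) (𝓝 ((1/π) * (Hc 0 0).re)) :=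
      (((Complex.continuous_re.comp (Hc_contx 0)).tendsto 0).mono_left nhdsWithin_le_nhds).const_mul _
    rw [Hc00] at h1
    simp only [Complex.ofReal_re] at h1
    rw [one_div_mul_cancel Real.pi_ne_zero] at h1
    simp only [zero_add, Real.Gamma_one, neg_zero, Real.rpow_zero, one_mul, div_one]
    refine h1.congr fun x => ?_
    rw [KK_eq]; simp
  · have hb : 0 < -a := by linarith
    have h1 : Tendsto (fun x : ℝ => (x / 2) ^ (-a) * (Hc a x).re) (𝓝[>] 0) (𝓝 0) :=
      tends_pow_mul hb (fun x hx => Hre a x)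
    have h2 := (h1.sub ((E_lim hb).const_mul (Real.sin (a * π)))).const_mul (1 / π)
    have e : 1 / π * (0 - Real.sin (a * π) * Real.Gamma (-a)) = 1 / Real.Gamma (a + 1) := by
      have r := Real.Gamma_mul_Gamma_one_sub (-a)
      rw [sub_neg_eq_add, add_comm 1 a] at r
      have hG : Real.Gamma (a + 1) ≠ 0 := (Real.Gamma_pos_of_pos (by linarith)).ne'
      have hs : 0 < Real.sin (π * -a) := Real.sin_pos_of_pos_of_lt_pi (by have := Real.pi_pos; positivity) (by nlinarith [Real.pi_pos])
      have e2 : Real.sin (a * π) = - Real.sin (π * -a) := by rw [← Real.sin_neg]; congr 1; ring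
      rw [e2]
      have hp := Real.pi_ne_zero
      rw [eq_div_iff hs.ne'] at r
      rw [eq_div_iff hG, one_div, inv_mul_eq_div, div_mul_eq_mul_div, div_eq_one_iff_eq hp]
      linear_combination r
    rw [e] at h2
    refine h2.congr fun x => ?_
    have e3 : EE (- -a) x = EE a x := by rw [neg_neg]
    rw [KK_eq]
    simp only [neg_neg]
    ring

lemma J_eq_K_base {ν : ℝ} (hν : 0 < ν) (hν1 : ν ≤ 1) {x : ℝ} (hx : 0 < x) :
    besselJ (ν - 1) x = KK (ν - 1) x ∧ besselJ ν x = KK ν x := by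
  obtain ⟨α, hα⟩ := K_prop hν
  have h1 := KK_lim (a := ν - 1) (by linarith) (by linarith)
  have h2 := (besselJ_lim (ν - 1)).const_mul α
  have hG : Real.Gamma (ν - 1 + 1) ≠ 0 := (Real.Gamma_pos_of_pos (by linarith)).ne'
  have : 1 / Real.Gamma (ν - 1 + 1) = α * (1 / Real.Gamma (ν - 1 + 1)) := by
    refine tendsto_nhds_unique (h1.congr' ?_) h2
    filter_upwards [self_mem_nhdsWithin] with y hy
    rw [(hα y hy).2.2]; ring
  have ha : α = 1 := by field_simp at this; exact this.symm
  subst ha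
  obtain ⟨p, _, q⟩ := hα x hx
  rw [p, q]; simp

lemma cyl_ext {F G : ℝ → ℝ → ℝ} (hF : Cyl F) (hG : Cyl G) {x : ℝ} (hx : 0 < x)
    (h : ∀ ν, 0 < ν → ν ≤ 1 → F (ν - 1) x = G (ν - 1) x ∧ F ν x = G ν x) (ν : ℝ) : F ν x = G ν x := by
  have key : ∀ n : ℕ, ∀ a : ℝ, 0 < a → a ≤ 1 → (F (a + n - 1) x = G (a + n - 1) x ∧ F (a + n) x = G (a + n) x)
      ∧ (F (a - n - 1) x = G (a - n - 1) x ∧ F (a - n) x = G (a - n) x) := by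
    intro n a ha ha1
    induction n with
    | zero => simpa using h a ha ha1
    | succ n ih =>
      obtain ⟨⟨p1, p2⟩, p3, p4⟩ := ih
      push_cast
      have f1 := hF.recr (a + n) x hx
      have g1 := hG.recr (a + n) x hx
      have f2 := hF.recr (a - n - 1) x hx
      have g2 := hG.recr (a - n - 1) x hx
      have e1 : a + (n + 1) - 1 = a + (n:ℝ) := by ring
      have e2 : a + ((n:ℝ) + 1) = a + n + 1 := by ring
      have e3 : a - ((n:ℝ) + 1) = a - n - 1 := by ring
      rw [e1, e2, e3]
      rw [sub_add_cancel] at f2 g2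
      rw [p1, p2] at f1
      rw [p3, p4] at f2
      exact ⟨⟨p2, by linarith⟩, by linarith, p3⟩
  have hc1 := Int.ceil_lt_add_one ν
  have hc2 := Int.le_ceil ν
  set m := ⌈ν⌉ with hm
  rcases le_total 1 m with h1 | h1
  · obtain ⟨n, hn⟩ := Int.eq_ofNat_of_zero_le (by linarith : 0 ≤ m - 1)
    have hn' : (m : ℝ) - 1 = n := by exact_mod_cast hn
    have := (key n (ν - n) (by linarith) (by linarith)).1.2
    simpa using this
  · obtain ⟨n, hn⟩ := Int.eq_ofNat_of_zero_le (by linarith : 0 ≤ 1 - m)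
    have hn' : 1 - (m : ℝ) = n := by exact_mod_cast hn
    have := (key n (ν + n) (by linarith) (by linarith)).2.2
    simpa using this

lemma J_eq_K (ν : ℝ) {x : ℝ} (hx : 0 < x) : besselJ ν x = KK ν x :=
  cyl_ext cylJ cylK hx (fun _ h0 h1 => J_eq_K_base h0 h1 hx) ν

lemma Y_eq_YY (ν : ℝ) {x : ℝ} (hx : 0 < x) : besselY ν x = YY ν x := by
  unfold besselY
  have hd : Dense {μ : ℝ | ∀ n : ℤ, μ ≠ (n : ℝ)} := by
    have : {μ : ℝ | ∀ n : ℤ, μ ≠ (n : ℝ)} = (range (fun n : ℤ => (n:ℝ)))ᶜ := by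
      ext μ; simp [eq_comm]
    rw [this]
    exact (countable_range _).dense_compl ℝ
  haveI : (𝓝[{μ : ℝ | ∀ n : ℤ, μ ≠ (n : ℝ)}] ν).NeBot := mem_closure_iff_nhdsWithin_neBot.mp (hd ν)
  apply Tendsto.limUnder_eq
  have hc : Continuous (fun μ => YY μ x) := Complex.continuous_im.comp (HH_cont x hx)
  refine ((hc.tendsto ν).mono_left nhdsWithin_le_nhds).congr' ?_
  filter_upwards [self_mem_nhdsWithin] with μ hμ
  have hs : Real.sin (μ * π) ≠ 0 := by
    intro h
    obtain ⟨n, hn⟩ := Real.sin_eq_zero_iff.mp h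
    exact hμ n (mul_right_cancel₀ Real.pi_ne_zero hn).symm
  rw [J_eq_K _ hx, J_eq_K _ hx, KK_neg]
  field_simp
  ring

end BD

namespace BD

open MeasureTheory

noncomputable def fz (ν : ℝ) (z : ℂ) : ℂ := Complex.exp (-(Complex.I * (ν * z)))

noncomputable def qz (ν : ℝ) (z : ℂ) : ℂ :=
  dslope (fz ν) ((π / 2 : ℝ) : ℂ) z / dslope Complex.cos ((π / 2 : ℝ) : ℂ) z

lemma fz_diff (ν : ℝ) : Differentiable ℂ (fz ν) := by
  unfold fz; fun_prop

lemma dslope_diff {f : ℂ → ℂ} (hf : Differentiable ℂ f) (c : ℂ) : Differentiable ℂ (dslope f c) := by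
  have := (Complex.differentiableOn_dslope (f := f) (c := c) (s := univ) univ_mem).mpr hf.differentiableOn
  exact differentiableOn_univ.mp this

lemma dcos_ne {θ : ℝ} (h0 : 0 ≤ θ) (h1 : θ ≤ π) : dslope Complex.cos ((π / 2 : ℝ) : ℂ) θ ≠ 0 := by
  by_cases h : θ = π / 2
  · subst h
    rw [dslope_same, Complex.deriv_cos, ← Complex.ofReal_sin, Real.sin_pi_div_two]
    simp
  · have h' : ((θ:ℝ) : ℂ) ≠ ((π / 2 : ℝ) : ℂ) := by exact_mod_cast h
    rw [dslope_of_ne _ h', slope_def_field, ← Complex.ofReal_cos, ← Complex.ofReal_cos, Real.cos_pi_div_two]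
    refine div_ne_zero ?_ (sub_ne_zero.mpr h')
    simp only [Complex.ofReal_zero, sub_zero]
    intro hc
    have hc : Real.cos θ = 0 := by exact_mod_cast hc
    apply h
    have := Real.injOn_cos ⟨h0, h1⟩ ⟨by positivity, by linarith [Real.pi_pos]⟩ (hc.trans Real.cos_pi_div_two.symm)
    exact this

lemma qz_mul (ν : ℝ) {θ : ℝ} (h0 : 0 ≤ θ) (h1 : θ ≤ π) :
    qz ν θ * Real.cos θ = ph (ν * θ) - ph (ν * π / 2) := by
  have hne := dcos_ne h0 h1
  have e1 := sub_smul_dslope (fz ν) ((π / 2 : ℝ) : ℂ) θ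
  have e2 := sub_smul_dslope Complex.cos ((π / 2 : ℝ) : ℂ) θ
  have hc : Complex.cos ((π / 2 : ℝ) : ℂ) = 0 := by rw [← Complex.ofReal_cos, Real.cos_pi_div_two]; simp
  rw [hc, sub_zero] at e2
  have e3 : ph (ν * θ) - ph (ν * π / 2) = fz ν θ - fz ν ((π / 2 : ℝ) : ℂ) := by
    unfold ph fz; push_cast; congr 4; ring
  rw [e3, ← e1, Complex.ofReal_cos, ← e2, qz]
  simp only [smul_eq_mul]
  field_simp

lemma qz_open : IsOpen {z : ℂ | dslope Complex.cos ((π / 2 : ℝ) : ℂ) z ≠ 0} :=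
  isOpen_ne_fun (dslope_diff Complex.differentiable_cos _).continuous continuous_const

lemma qz_diff (ν : ℝ) : DifferentiableOn ℂ (qz ν) {z : ℂ | dslope Complex.cos ((π / 2 : ℝ) : ℂ) z ≠ 0} := by
  unfold qz
  exact (dslope_diff (fz_diff ν) _).differentiableOn.div (dslope_diff Complex.differentiable_cos _).differentiableOn (fun z hz => hz)

lemma Hc_asym (ν : ℝ) : ∃ C : ℝ, 0 ≤ C ∧ ∀ x, 0 < x → ‖Hc ν x - ph (ν * π / 2) * Hc 0 x‖ ≤ C / x := by
  set S := {z : ℂ | dslope Complex.cos ((π / 2 : ℝ) : ℂ) z ≠ 0} with hS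
  have hmem : ∀ θ ∈ uIcc 0 π, ((θ:ℝ):ℂ) ∈ S := by
    intro θ hθ
    rw [uIcc_of_le Real.pi_pos.le] at hθ
    exact dcos_ne hθ.1 hθ.2
  have hd : ∀ θ ∈ uIcc 0 π, HasDerivAt (fun θ : ℝ => qz ν θ) (deriv (qz ν) θ) θ := fun θ hθ =>
    (((qz_diff ν).differentiableAt (qz_open.mem_nhds (hmem θ hθ))).hasDerivAt).comp_ofReal
  have hdc : ContinuousOn (fun θ : ℝ => deriv (qz ν) θ) (uIcc 0 π) :=
    ((qz_diff ν).deriv qz_open).continuousOn.comp Complex.continuous_ofReal.continuousOn hmem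
  have hIntg : IntervalIntegrable (fun θ : ℝ => deriv (qz ν) θ) volume 0 π := hdc.intervalIntegrable
  refine ⟨‖qz ν (π:ℝ)‖ + ‖qz ν (0:ℝ)‖ + ∫ θ in (0:ℝ)..π, ‖deriv (qz ν) θ‖, ?_, fun x hx => ?_⟩
  · have := intervalIntegral.integral_nonneg (μ := volume) Real.pi_pos.le (fun θ _ => norm_nonneg (deriv (qz ν) (θ:ℂ)))
    positivity
  · have hk : ∀ θ ∈ uIcc 0 π, HasDerivAt (ker 0 x) (Complex.I * (x * Real.cos θ) * ker 0 x θ) θ := by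
      intro θ _
      simpa using ker_hasDerivAt_t 0 x θ
    have hki : IntervalIntegrable (fun θ : ℝ => Complex.I * (x * Real.cos θ) * ker 0 x θ) volume 0 π := by
      apply Continuous.intervalIntegrable
      have := ker_cont 0 x
      fun_prop
    have ibp := intervalIntegral.integral_mul_deriv_eq_deriv_mul hd hk hIntg hki
    have e : Complex.I * x * (Hc ν x - ph (ν * π / 2) * Hc 0 x) =
        ∫ θ in (0:ℝ)..π, qz ν θ * (Complex.I * (x * Real.cos θ) * ker 0 x θ) := by
      unfold Hc
      rw [← intervalIntegral.integral_const_mul, ← intervalIntegral.integral_sub (ker_int ν x) ((ker_int 0 x).const_mul _),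
        ← intervalIntegral.integral_const_mul]
      refine intervalIntegral.integral_congr fun θ hθ => ?_
      rw [uIcc_of_le Real.pi_pos.le] at hθ
      have q := qz_mul ν hθ.1 hθ.2
      have s := ker_shift 0 x θ ν
      rw [zero_add] at s
      rw [s]
      linear_combination (-(Complex.I * x * ker 0 x θ)) * q
    have hb : ‖Complex.I * x * (Hc ν x - ph (ν * π / 2) * Hc 0 x)‖ ≤ ‖qz ν (π:ℝ)‖ + ‖qz ν (0:ℝ)‖ + ∫ θ in (0:ℝ)..π, ‖deriv (qz ν) θ‖ := by
      rw [e, ibp]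
      refine (norm_sub_le _ _).trans (add_le_add ((norm_sub_le _ _).trans ?_) ?_)
      · rw [norm_mul, norm_mul, ker_norm, ker_norm, mul_one, mul_one]
      · refine (intervalIntegral.norm_integral_le_integral_norm Real.pi_pos.le).trans (le_of_eq ?_)
        refine intervalIntegral.integral_congr fun θ _ => ?_
        simp only [norm_mul, ker_norm, mul_one]
    rw [norm_mul, norm_mul, Complex.norm_I, one_mul, Complex.norm_real, Real.norm_of_nonneg hx.le] at hb
    rw [le_div_iff₀ hx]
    linarith

noncomputable def I0 (x : ℝ) : ℂ := (1 / π : ℝ) * Hc 0 x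

lemma I0_norm (x : ℝ) : ‖I0 x‖ ≤ 1 := by
  unfold I0
  have := Hc_norm 0 x
  rw [norm_mul, Complex.norm_real, Real.norm_of_nonneg (by positivity), one_div, inv_mul_le_iff₀ Real.pi_pos]
  simpa using this

lemma HH_asym (ν : ℝ) : ∃ C : ℝ, 0 ≤ C ∧ ∀ x, 1 ≤ x → ‖HH ν x - ph (ν * π / 2) * I0 x‖ ≤ C / x := by
  obtain ⟨C1, h1, H1⟩ := Hc_asym ν
  obtain ⟨C2, h2, H2⟩ := E_le_large ν
  obtain ⟨C3, h3, H3⟩ := E_le_large (-ν)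
  refine ⟨(1 / π) * (C1 + (C3 + C2)), by positivity, fun x hx => ?_⟩
  have e : HH ν x - ph (ν * π / 2) * I0 x = ((1 / π : ℝ) : ℂ) * ((Hc ν x - ph (ν * π / 2) * Hc 0 x) - Complex.I * (EE (-ν) x + ph (ν * π) * EE ν x)) := by
    unfold HH I0; push_cast; ring
  rw [e, norm_mul, Complex.norm_real, Real.norm_of_nonneg (by positivity : (0:ℝ) ≤ 1 / π), mul_div_assoc (1 / π)]
  refine mul_le_mul_of_nonneg_left ?_ (by positivity)
  rw [add_div C1, add_div C3]
  refine (norm_sub_le _ _).trans (add_le_add (H1 x (by linarith)) ?_)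
  rw [norm_mul, Complex.norm_I, one_mul]
  refine (norm_add_le _ _).trans (add_le_add ?_ ?_)
  · rw [Complex.norm_real, Real.norm_of_nonneg (E_nonneg _ _)]; exact H3 x hx
  · rw [norm_mul, ph_norm, one_mul, Complex.norm_real, Real.norm_of_nonneg (E_nonneg _ _)]; exact H2 x hx

lemma HH_le (ν : ℝ) : ∃ C : ℝ, 0 ≤ C ∧ ∀ x, 1 ≤ x → ‖HH ν x‖ ≤ ‖I0 x‖ + C / x := by
  obtain ⟨C, h, H⟩ := HH_asym ν
  refine ⟨C, h, fun x hx => ?_⟩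
  have := H x hx
  have e : HH ν x = ph (ν * π / 2) * I0 x + (HH ν x - ph (ν * π / 2) * I0 x) := by ring
  rw [e]
  refine (norm_add_le _ _).trans (add_le_add ?_ this)
  rw [norm_mul, ph_norm, one_mul]

lemma I0_large : Tendsto (fun x => x * ‖I0 x‖) atTop atTop := by
  obtain ⟨C1, h1, H1⟩ := HH_le 1
  obtain ⟨C2, h2, H2⟩ := HH_le (1 + 1)
  have key : ∀ x, 1 ≤ x → Real.sqrt (x / π) - (C1 + C2) ≤ x * ‖I0 x‖ := by
    intro x hx
    have hx0 : 0 < x := by linarith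
    have w := JY_wr (ν := 1) one_pos hx0
    rw [J_eq_K _ hx0, J_eq_K _ hx0] at w
    have a1 := (Complex.abs_re_le_norm (HH 1 x)).trans (H1 x hx)
    have a2 := (Complex.abs_im_le_norm (HH 1 x)).trans (H1 x hx)
    have a3 := (Complex.abs_re_le_norm (HH (1+1) x)).trans (H2 x hx)
    have a4 := (Complex.abs_im_le_norm (HH (1+1) x)).trans (H2 x hx)
    set A := ‖I0 x‖ + (C1 + C2) / x with hA
    have hb1 : ‖I0 x‖ + C1 / x ≤ A := by rw [hA, add_div]; have : 0 ≤ C2 / x := by positivity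
                                         linarith
    have hb2 : ‖I0 x‖ + C2 / x ≤ A := by rw [hA, add_div]; have : 0 ≤ C1 / x := by positivity
                                         linarith
    have hA0 : 0 ≤ A := by positivity
    have b1 : |KK (1+1) x * YY 1 x| ≤ A * A := by
      rw [abs_mul]; exact mul_le_mul (a3.trans hb2) (a2.trans hb1) (abs_nonneg _) hA0
    have b2 : |KK 1 x * YY (1+1) x| ≤ A * A := by
      rw [abs_mul]; exact mul_le_mul (a1.trans hb1) (a4.trans hb2) (abs_nonneg _) hA0
    have b3 : KK (1+1) x * YY 1 x - KK 1 x * YY (1+1) x ≤ 2 * (A * A) := by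
      have := abs_le.mp b1; have := abs_le.mp b2; linarith
    have b4 : 2 / π ≤ x * (2 * (A * A)) := by rw [← w]; exact mul_le_mul_of_nonneg_left b3 hx0.le
    have b5 : Real.sqrt (x / π) ≤ x * A := by
      rw [Real.sqrt_le_left (by positivity)]
      have : x * (2 / π) ≤ x * (x * (2 * (A * A))) := mul_le_mul_of_nonneg_left b4 hx0.le
      have e : x / π = x * (2 / π) / 2 := by ring
      rw [e]; nlinarith
    have b6 : x * A = x * ‖I0 x‖ + (C1 + C2) := by rw [hA]; field_simp
    linarith
  have hs : Tendsto (fun x : ℝ => Real.sqrt (x / π) - (C1 + C2)) atTop atTop :=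
    tendsto_atTop_add_const_right _ _ (Real.tendsto_sqrt_atTop.comp (tendsto_id.atTop_div_const Real.pi_pos))
  refine tendsto_atTop_mono' _ ?_ hs
  filter_upwards [eventually_ge_atTop 1] with x hx using key x hx

/-- derivative functions -/
noncomputable def dK (ν x : ℝ) : ℝ := ν / x * KK ν x - KK (ν + 1) x
noncomputable def dY (ν x : ℝ) : ℝ := ν / x * YY ν x - YY (ν + 1) x

noncomputable def zJ (ν x : ℝ) : ℂ := ⟨dK ν x, KK ν x⟩
noncomputable def zY (ν x : ℝ) : ℂ := ⟨dY ν x, YY ν x⟩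

lemma norm_le_re_im (z : ℂ) {a b : ℝ} (h1 : |z.re| ≤ a) (h2 : |z.im| ≤ b) : ‖z‖ ≤ a + b :=
  (Complex.norm_le_abs_re_add_abs_im z).trans (add_le_add h1 h2)

lemma dH_asym (ν : ℝ) : ∃ C : ℝ, 0 ≤ C ∧ ∀ x, 1 ≤ x → ‖(ν / x * HH ν x - HH (ν + 1) x) - Complex.I * (ph (ν * π / 2) * I0 x)‖ ≤ C / x := by
  obtain ⟨C1, h1, H1⟩ := HH_le ν
  obtain ⟨C2, h2, H2⟩ := HH_asym (ν + 1)
  refine ⟨|ν| * (1 + C1) + C2, by positivity, fun x hx => ?_⟩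
  have hx0 : 0 < x := by linarith
  have e : ph ((ν + 1) * π / 2) = - Complex.I * ph (ν * π / 2) := by
    have : (ν + 1) * π / 2 = ν * π / 2 + π / 2 := by ring
    rw [this, ph_add]
    have : ph (π / 2) = - Complex.I := by
      apply Complex.ext <;> simp [ph_re, ph_im]
    rw [this]; ring
  have H2 := H2 x hx
  rw [e] at H2
  have e2 : (ν / x * HH ν x - HH (ν + 1) x) - Complex.I * (ph (ν * π / 2) * I0 x) =
    ν / x * HH ν x - (HH (ν + 1) x - -Complex.I * ph (ν * π / 2) * I0 x) := by ring
  rw [e2, add_div]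
  refine (norm_sub_le _ _).trans (add_le_add ?_ H2)
  rw [norm_mul, norm_div, Complex.norm_real, Complex.norm_real, Real.norm_of_nonneg hx0.le, Real.norm_eq_abs, mul_div_right_comm]
  refine mul_le_mul_of_nonneg_left ?_ (by positivity)
  have := H1 x hx
  have i := I0_norm x
  have : C1 / x ≤ C1 := div_le_self h1 hx
  linarith

lemma z_asym (ν : ℝ) : ∃ C : ℝ, ∀ x, 1 ≤ x → ‖zJ ν x - Complex.I * ph (ν * π / 2) * I0 x‖ ≤ C / x ∧
    ‖zY ν x - ph (ν * π / 2) * I0 x‖ ≤ C / x := by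
  obtain ⟨C1, h1, H1⟩ := HH_asym ν
  obtain ⟨C2, h2, H2⟩ := dH_asym ν
  refine ⟨C2 + C1, fun x hx => ?_⟩
  have H1 := H1 x hx
  have H2 := H2 x hx
  set w := ph (ν * π / 2) * I0 x with hw
  have r1 := (Complex.abs_re_le_norm _).trans H1
  have i1 := (Complex.abs_im_le_norm _).trans H1
  have r2 := (Complex.abs_re_le_norm _).trans H2
  have i2 := (Complex.abs_im_le_norm _).trans H2
  have hdr : (ν / x * HH ν x - HH (ν + 1) x : ℂ).re = dK ν x := by
    rw [← Complex.ofReal_div, Complex.sub_re, Complex.re_ofReal_mul]; rfl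
  have hdi : (ν / x * HH ν x - HH (ν + 1) x : ℂ).im = dY ν x := by
    rw [← Complex.ofReal_div, Complex.sub_im, Complex.im_ofReal_mul]; rfl
  rw [Complex.sub_re] at r1 r2
  rw [Complex.sub_im] at i1 i2
  rw [hdr] at r2
  rw [hdi] at i2
  rw [add_div]
  constructor
  · apply norm_le_re_im
    · rw [mul_assoc, ← hw, Complex.sub_re]; exact r2
    · rw [mul_assoc, ← hw, Complex.sub_im, Complex.I_mul_im]; exact r1
  · apply norm_le_re_im
    · rw [Complex.sub_re]
      rw [Complex.I_mul_im] at i2; exact i2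
    · rw [Complex.sub_im]; exact i1

lemma ratio_lim {z : ℝ → ℂ} {e : ℂ} {C : ℝ} (h : ∀ x, 1 ≤ x → ‖z x - e * I0 x‖ ≤ C / x) :
    Tendsto (fun x => z x / I0 x) atTop (𝓝 e) := by
  rw [tendsto_iff_norm_sub_tendsto_zero]
  have h0 : Tendsto (fun x => C / (x * ‖I0 x‖)) atTop (𝓝 0) := I0_large.const_div_atTop C
  refine squeeze_zero' (Eventually.of_forall fun _ => norm_nonneg _) ?_ h0
  filter_upwards [eventually_ge_atTop 1, I0_large.eventually_gt_atTop 0] with x hx hI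
  have hx0 : 0 < x := by linarith
  have hI : 0 < ‖I0 x‖ := pos_of_mul_pos_right hI hx0.le
  have hI0 : I0 x ≠ 0 := norm_pos_iff.mp hI
  have e1 : z x / I0 x - e = (z x - e * I0 x) / I0 x := by field_simp
  rw [e1, norm_div, ← div_div]
  exact div_le_div_of_nonneg_right (h x hx) hI.le

lemma cos_lim {z1 z2 : ℝ → ℂ} {e1 e2 : ℂ} {C1 C2 : ℝ} (h1 : ∀ x, 1 ≤ x → ‖z1 x - e1 * I0 x‖ ≤ C1 / x)
    (h2 : ∀ x, 1 ≤ x → ‖z2 x - e2 * I0 x‖ ≤ C2 / x) (he1 : ‖e1‖ = 1) (he2 : ‖e2‖ = 1) :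
    Tendsto (fun x => (z1 x * (starRingEnd ℂ) (z2 x)).re / (‖z1 x‖ * ‖z2 x‖)) atTop (𝓝 (e1 * (starRingEnd ℂ) e2).re) := by
  have l1 := ratio_lim h1
  have l2 := ratio_lim h2
  have l3 := ((Complex.continuous_re.tendsto _).comp (l1.mul ((Complex.continuous_conj.tendsto _).comp l2))).div (l1.norm.mul l2.norm) (by rw [he1, he2]; norm_num)
  rw [he1, he2, mul_one, div_one] at l3
  refine l3.congr' ?_
  filter_upwards [eventually_ge_atTop 1, I0_large.eventually_gt_atTop 0] with x hx hI
  have hx0 : 0 < x := by linarith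
  have hI : 0 < ‖I0 x‖ := pos_of_mul_pos_right hI hx0.le
  have hI0 : I0 x ≠ 0 := norm_pos_iff.mp hI
  simp only [Function.comp, Pi.div_apply, norm_div, map_div₀]
  have e : z1 x / I0 x * ((starRingEnd ℂ) (z2 x) / (starRingEnd ℂ) (I0 x)) =
      ((1 / (‖I0 x‖ ^ 2) : ℝ) : ℂ) * (z1 x * (starRingEnd ℂ) (z2 x)) := by
    rw [div_mul_div_comm, Complex.mul_conj, Complex.normSq_eq_norm_sq]
    push_cast; ring
  rw [e, Complex.re_ofReal_mul]
  by_cases hz : ‖z1 x‖ * ‖z2 x‖ = 0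
  · have : z1 x = 0 ∨ z2 x = 0 := by simpa using hz
    rcases this with h | h <;> simp [h]
  · have := left_ne_zero_of_mul hz
    have := right_ne_zero_of_mul hz
    field_simp

end BD

namespace BD

open MeasureTheory

noncomputable def Gf (ν θ : ℝ) : ℝ :=
  Real.sin (ν * (θ - Real.sin θ)) / ν * Real.sin θ / (1 - Real.cos θ)
    + (1 - Real.cos (ν * (θ - Real.sin θ))) / ν ^ 2 / (1 - Real.cos θ) ^ 2

noncomputable def Rf (ν θ : ℝ) : ℝ :=
  2 * Real.sin θ * (1 - Real.cos (ν * (θ - Real.sin θ))) / ν ^ 2 / (1 - Real.cos θ) ^ 3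

lemma one_sub_cos_pos {θ : ℝ} (h0 : 0 < θ) (h1 : θ ≤ π) : 2 / π ^ 2 * θ ^ 2 ≤ 1 - Real.cos θ := by
  have := Real.cos_le_one_sub_mul_cos_sq (x := θ) (by rw [abs_of_pos h0]; exact h1)
  linarith

lemma Gf_deriv {ν θ : ℝ} (hν : 0 < ν) (h0 : 0 < θ) (h1 : θ ≤ π) :
    HasDerivAt (Gf ν) (Real.cos (ν * (θ - Real.sin θ)) * Real.sin θ - Rf ν θ) θ := by
  have hc : 0 < 1 - Real.cos θ := lt_of_lt_of_le (by positivity) (one_sub_cos_pos h0 h1)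
  have hp : HasDerivAt (fun θ => ν * (θ - Real.sin θ)) (ν * (1 - Real.cos θ)) θ :=
    ((hasDerivAt_id θ).sub (Real.hasDerivAt_sin θ)).const_mul ν
  have hcd : HasDerivAt (fun θ => 1 - Real.cos θ) (Real.sin θ) θ := by
    simpa using (Real.hasDerivAt_cos θ).const_sub 1
  have h := (((hp.sin.div_const ν).mul (Real.hasDerivAt_sin θ)).div hcd hc.ne').add
    (((hp.cos.const_sub 1).div_const (ν ^ 2)).div (hcd.pow 2) (pow_ne_zero 2 hc.ne'))
  refine HasDerivAt.congr_deriv (h.congr_of_eventuallyEq (Eventually.of_forall fun y => rfl)) ?_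
  unfold Rf
  simp only [Pi.mul_apply, Pi.pow_apply]
  have h2 : Real.sin θ ^ 2 = 1 - Real.cos θ ^ 2 := Real.sin_sq θ
  field_simp
  ring_nf
  rw [h2]
  ring

lemma Rf_nonneg {ν θ : ℝ} (hν : 0 < ν) (h0 : 0 < θ) (h1 : θ ≤ π) : 0 ≤ Rf ν θ := by
  have hc : 0 < 1 - Real.cos θ := lt_of_lt_of_le (by positivity) (one_sub_cos_pos h0 h1)
  have hs : 0 ≤ Real.sin θ := Real.sin_nonneg_of_nonneg_of_le_pi h0.le h1
  have hcc : 0 ≤ 1 - Real.cos (ν * (θ - Real.sin θ)) := by linarith [Real.cos_le_one (ν * (θ - Real.sin θ))]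
  unfold Rf
  positivity

lemma Gf_bound {ν θ : ℝ} (hν : 0 < ν) (h0 : 0 < θ) (h1 : θ ≤ 1) :
    |Gf ν θ| ≤ (π ^ 2 / 2 + (π ^ 2 / 2) ^ 2) * θ := by
  have hpi := Real.pi_gt_three
  have hθπ : θ ≤ π := by linarith
  have hc0 := one_sub_cos_pos h0 hθπ
  have hκ : 0 < 2 / π ^ 2 * θ ^ 2 := by positivity
  set c := 1 - Real.cos θ with hc
  set ψ := θ - Real.sin θ with hψ
  have hψ0 : 0 ≤ ψ := by have := Real.sin_lt h0; linarith
  have hψ1 : ψ ≤ θ ^ 3 := by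
    have := Real.sin_gt_sub_cube h0 
    have : 0 < θ ^ 3 := by positivity
    linarith
  have hs0 : 0 ≤ Real.sin θ := Real.sin_nonneg_of_nonneg_of_le_pi h0.le hθπ
  have hs1 : Real.sin θ ≤ θ := (Real.sin_lt h0).le
  have hS : |Real.sin (ν * ψ)| ≤ ν * θ ^ 3 := by
    refine (Real.abs_sin_le_abs).trans ?_
    rw [abs_of_nonneg (by positivity)]
    exact mul_le_mul_of_nonneg_left hψ1 hν.le
  have hC : 1 - Real.cos (ν * ψ) ≤ ν ^ 2 * θ ^ 6 := by
    have := Real.one_sub_sq_div_two_le_cos (x := ν * ψ)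
    have h3 : (ν * ψ) ^ 2 ≤ (ν * θ ^ 3) ^ 2 := by gcongr
    nlinarith [sq_nonneg (ν * ψ)]
  have hC0 : 0 ≤ 1 - Real.cos (ν * ψ) := by linarith [Real.cos_le_one (ν * ψ)]
  unfold Gf
  rw [← hc, ← hψ]
  have hcp : 0 < c := by linarith
  have t1 : |Real.sin (ν * ψ) / ν * Real.sin θ / c| ≤ (π ^ 2 / 2) * θ := by
    rw [abs_div, abs_mul, abs_div, abs_of_pos hν, abs_of_pos hcp, abs_of_nonneg hs0]
    calc |Real.sin (ν * ψ)| / ν * Real.sin θ / c ≤ (ν * θ ^ 3) / ν * θ / (2 / π ^ 2 * θ ^ 2) := by gcongr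
      _ = (π ^ 2 / 2) * θ ^ 2 := by field_simp
      _ ≤ _ := by gcongr; nlinarith
  have t2 : |(1 - Real.cos (ν * ψ)) / ν ^ 2 / c ^ 2| ≤ (π ^ 2 / 2) ^ 2 * θ := by
    rw [abs_of_nonneg (by positivity)]
    calc (1 - Real.cos (ν * ψ)) / ν ^ 2 / c ^ 2 ≤ (ν ^ 2 * θ ^ 6) / ν ^ 2 / (2 / π ^ 2 * θ ^ 2) ^ 2 := by gcongr
      _ = (π ^ 2 / 2) ^ 2 * θ ^ 2 := by field_simp
      _ ≤ _ := by gcongr; nlinarith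
  refine (abs_add_le _ _).trans ?_
  linarith

lemma osc_nonneg {ν : ℝ} (hν : 0 < ν) :
    0 ≤ ∫ θ in (0:ℝ)..π, Real.cos (ν * (θ - Real.sin θ)) * Real.sin θ := by
  set g := fun θ : ℝ => Real.cos (ν * (θ - Real.sin θ)) * Real.sin θ with hg
  have hgc : Continuous g := by fun_prop
  set P := fun x => (∫ θ in (0:ℝ)..x, g θ) - Gf ν x with hP
  have hPd : ∀ x, 0 < x → x ≤ π → HasDerivAt P (Rf ν x) x := by
    intro x h0 h1
    have := (hgc.integral_hasStrictDerivAt 0 x).hasDerivAt.sub (Gf_deriv hν h0 h1)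
    refine HasDerivAt.congr_deriv (this.congr_of_eventuallyEq (Eventually.of_forall fun y => rfl)) ?_
    simp only [hg]; ring
  have hmono : MonotoneOn P (Ioc 0 π) := by
    refine monotoneOn_of_deriv_nonneg (convex_Ioc 0 π)
      (fun x hx => (hPd x hx.1 hx.2).continuousAt.continuousWithinAt) ?_ ?_
    · intro x hx
      rw [interior_Ioc] at hx
      exact (hPd x hx.1 hx.2.le).differentiableAt.differentiableWithinAt
    · intro x hx
      rw [interior_Ioc] at hx
      rw [(hPd x hx.1 hx.2.le).deriv]
      exact Rf_nonneg hν hx.1 hx.2.le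
  have hlim : Tendsto P (𝓝[>] 0) (𝓝 0) := by
    have l1 : Tendsto (fun x => ∫ θ in (0:ℝ)..x, g θ) (𝓝[>] 0) (𝓝 0) := by
      have := ((intervalIntegral.continuous_primitive (μ := volume) (fun a b => hgc.intervalIntegrable a b) 0).tendsto 0).mono_left (nhdsWithin_le_nhds (s := Ioi 0))
      simpa using this
    have l2 : Tendsto (Gf ν) (𝓝[>] 0) (𝓝 0) := by
      have l3 : Tendsto (fun x : ℝ => (π ^ 2 / 2 + (π ^ 2 / 2) ^ 2) * x) (𝓝[>] 0) (𝓝 0) := by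
        have : Tendsto (fun x : ℝ => (π ^ 2 / 2 + (π ^ 2 / 2) ^ 2) * x) (𝓝 0) (𝓝 ((π ^ 2 / 2 + (π ^ 2 / 2) ^ 2) * 0)) := (continuous_const.mul continuous_id).tendsto 0
        rw [mul_zero] at this
        exact this.mono_left nhdsWithin_le_nhds
      refine squeeze_zero_norm' ?_ l3
      filter_upwards [Ioc_mem_nhdsGT (one_pos : (0:ℝ) < 1)] with x hx using Gf_bound hν hx.1 hx.2
    simpa using l1.sub l2
  have hPπ : 0 ≤ P π := by
    refine le_of_tendsto hlim ?_
    filter_upwards [Ioc_mem_nhdsGT Real.pi_pos] with x hx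
    exact hmono hx ⟨Real.pi_pos, le_rfl⟩ hx.2
  have hGπ : 0 ≤ Gf ν π := by
    unfold Gf
    simp only [Real.sin_pi, mul_zero, zero_div, zero_add]
    have : 0 ≤ 1 - Real.cos (ν * (π - 0)) := by linarith [Real.cos_le_one (ν * (π - 0))]
    positivity
  simp only [hP] at hPπ
  linarith

lemma sinh_int (ν : ℝ) {x : ℝ} (hx : 0 < x) :
    IntegrableOn (fun t => Real.sinh t * Real.exp (-x * Real.sinh t - ν * t)) (Ioi 0) := by
  have h := ((E_int (ν - 1) hx).sub (E_int (ν + 1) hx)).div_const 2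
  refine h.congr (Eventually.of_forall fun t => ?_)
  have := sinh_mul_exp ν x t
  simp only [Pi.sub_apply]
  linarith

lemma sinh_part {ν x : ℝ} (hν : 0 < ν) (hx : 0 < x) :
    0 < (∫ t in Ioi (0:ℝ), Real.sinh t * Real.exp (-x * Real.sinh t - (-ν) * t)) +
      Real.cos (ν * π) * ∫ t in Ioi (0:ℝ), Real.sinh t * Real.exp (-x * Real.sinh t - ν * t) := by
  set A := ∫ t in Ioi (0:ℝ), Real.sinh t * Real.exp (-x * Real.sinh t - (-ν) * t)
  set B := ∫ t in Ioi (0:ℝ), Real.sinh t * Real.exp (-x * Real.sinh t - ν * t)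
  have hB : 0 ≤ B := setIntegral_nonneg measurableSet_Ioi fun t ht =>
    mul_nonneg (Real.sinh_nonneg_iff.mpr (le_of_lt ht)) (Real.exp_pos _).le
  have hpos : ∀ t ∈ Ioi (0:ℝ), 0 < Real.sinh t * Real.exp (-x * Real.sinh t - (-ν) * t) - Real.sinh t * Real.exp (-x * Real.sinh t - ν * t) := by
    intro t ht
    have ht : 0 < t := ht
    rw [← mul_sub]
    refine mul_pos (Real.sinh_pos_iff.mpr ht) (sub_pos.mpr (Real.exp_lt_exp.mpr ?_))
    nlinarith [mul_pos hν ht]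
  have hAB : 0 < A - B := by
    rw [← integral_sub (sinh_int (-ν) hx) (sinh_int ν hx)]
    rw [setIntegral_pos_iff_support_of_nonneg_ae]
    · refine lt_of_lt_of_le ?_ (measure_mono (s := Ioi (0:ℝ)) ?_)
      · simp
      · intro t ht; exact ⟨(hpos t ht).ne', ht⟩
    · exact (ae_restrict_iff' measurableSet_Ioi).mpr (Eventually.of_forall fun t ht => (hpos t ht).le)
    · exact (sinh_int (-ν) hx).sub (sinh_int ν hx)
  have := Real.neg_one_le_cos (ν * π)
  nlinarith

lemma ker_im (ν x θ : ℝ) : (Complex.I * (Real.sin θ : ℂ) * ker ν x θ).im = Real.cos (x * Real.sin θ - ν * θ) * Real.sin θ := by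
  unfold ker
  generalize x * Real.sin θ - ν * θ = y
  rw [mul_comm Complex.I (y : ℂ), Complex.exp_mul_I, ← Complex.ofReal_cos, ← Complex.ofReal_sin, mul_assoc, Complex.I_mul_im,
    Complex.re_ofReal_mul]
  simp only [Complex.add_re, Complex.ofReal_re, Complex.re_ofReal_mul, Complex.I_re]
  ring

lemma dY_formula (ν : ℝ) {x : ℝ} (hx : 0 < x) : dY ν x = (1 / π) * ((∫ θ in (0:ℝ)..π, Real.cos (x * Real.sin θ - ν * θ) * Real.sin θ)
    + ((∫ t in Ioi (0:ℝ), Real.sinh t * Real.exp (-x * Real.sinh t - (-ν) * t)) +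
      Real.cos (ν * π) * ∫ t in Ioi (0:ℝ), Real.sinh t * Real.exp (-x * Real.sinh t - ν * t))) := by
  have h1 := YY_hasDerivAt ν hx
  have hi : HasDerivAt (fun x => (Hc ν x).im) (∫ θ in (0:ℝ)..π, Complex.I * (Real.sin θ : ℂ) * ker ν x θ).im x := by
    have := (Complex.imCLM.hasFDerivAt (x := Hc ν x)).comp_hasDerivAt x (Hc_hasDerivAt' ν x)
    exact this
  have h2 := (((hi.sub (E_hasDerivAt' (-ν) hx)).sub ((E_hasDerivAt' ν hx).const_mul (Real.cos (ν * π)))).const_mul (1 / π))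
  have h3 := h1.unique (h2.congr_of_eventuallyEq (Eventually.of_forall fun y => YY_eq ν y))
  unfold dY
  rw [h3]
  congr 1
  have ei : (∫ θ in (0:ℝ)..π, Complex.I * (Real.sin θ : ℂ) * ker ν x θ).im = ∫ θ in (0:ℝ)..π, Real.cos (x * Real.sin θ - ν * θ) * Real.sin θ := by
    have hIntg : IntervalIntegrable (fun θ : ℝ => Complex.I * (Real.sin θ : ℂ) * ker ν x θ) volume 0 π := by
      apply Continuous.intervalIntegrable
      have := ker_cont ν x
      fun_prop
    have := Complex.imCLM.intervalIntegral_comp_comm hIntg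
    simp only [Complex.imCLM_apply] at this
    rw [← this]
    simp only [ker_im]
  rw [ei]
  simp only [neg_mul, integral_neg]
  ring

lemma dY_nu_pos {ν : ℝ} (hν : 0 < ν) : 0 < dY ν ν := by
  rw [dY_formula ν hν]
  have h1 := osc_nonneg hν
  have h2 := sinh_part hν hν
  have e : (∫ θ in (0:ℝ)..π, Real.cos (ν * Real.sin θ - ν * θ) * Real.sin θ) = ∫ θ in (0:ℝ)..π, Real.cos (ν * (θ - Real.sin θ)) * Real.sin θ := by
    congr 1; ext θ; rw [← Real.cos_neg]; congr 2; ring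
  rw [e]
  have := Real.pi_pos
  positivity

end BD

namespace BD

open MeasureTheory

structure Sol (ν : ℝ) (u v : ℝ → ℝ) : Prop where
  du : ∀ x, 0 < x → HasDerivAt u (v x) x
  dv : ∀ x, 0 < x → HasDerivAt v (-(v x) / x - (1 - ν ^ 2 / x ^ 2) * u x) x

lemma Cyl.sol {F : ℝ → ℝ → ℝ} (h : Cyl F) (ν : ℝ) : Sol ν (F ν) (fun x => ν / x * F ν x - F (ν + 1) x) := by
  refine ⟨fun x hx => h.der ν x hx, fun x hx => ?_⟩
  have h1 : HasDerivAt (fun x : ℝ => ν / x) (-ν / x ^ 2) x := by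
    have := (hasDerivAt_inv hx.ne').const_mul ν
    refine HasDerivAt.congr_deriv (this.congr_of_eventuallyEq (Eventually.of_forall fun y => ?_)) ?_
    · simp [div_eq_mul_inv]
    · ring
  have h2 := (h1.mul (h.der ν x hx)).sub (h.der' ν x hx)
  refine HasDerivAt.congr_deriv (h2.congr_of_eventuallyEq (Eventually.of_forall fun y => rfl)) ?_
  field_simp
  ring

lemma solK (ν : ℝ) : Sol ν (KK ν) (dK ν) := cylK.sol ν
lemma solY (ν : ℝ) : Sol ν (YY ν) (dY ν) := cylY.sol ν

lemma KY_wr {ν : ℝ} (hν : 0 < ν) {x : ℝ} (hx : 0 < x) : KK ν x * dY ν x - dK ν x * YY ν x = 2 / (π * x) := by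
  have h := JY_wr hν hx
  rw [J_eq_K _ hx, J_eq_K _ hx] at h
  have e : KK ν x * dY ν x - dK ν x * YY ν x = (x * (KK (ν + 1) x * YY ν x - KK ν x * YY (ν + 1) x)) / x := by
    unfold dK dY; field_simp; ring
  rw [e, h, div_div]

lemma K_nz {ν : ℝ} (hν : 0 < ν) {x : ℝ} (hx : 0 < x) : KK ν x ≠ 0 ∨ dK ν x ≠ 0 := by
  by_contra! h
  have := KY_wr hν hx
  rw [h.1, h.2] at this
  have h2 : 0 < 2 / (π * x) := by have := Real.pi_pos; positivity
  linarith

lemma Y_nz {ν : ℝ} (hν : 0 < ν) {x : ℝ} (hx : 0 < x) : YY ν x ≠ 0 ∨ dY ν x ≠ 0 := by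
  by_contra! h
  have := KY_wr hν hx
  rw [h.1, h.2] at this
  have h2 : 0 < 2 / (π * x) := by have := Real.pi_pos; positivity
  linarith

section
variable {ν : ℝ} {u v : ℝ → ℝ}

lemma Sol.cu (h : Sol ν u v) : ContinuousOn u (Ioi 0) := fun x hx => (h.du x hx).continuousAt.continuousWithinAt
lemma Sol.cv (h : Sol ν u v) : ContinuousOn v (Ioi 0) := fun x hx => (h.dv x hx).continuousAt.continuousWithinAt

lemma Sol.dxuv (h : Sol ν u v) {x : ℝ} (hx : 0 < x) :
    HasDerivAt (fun x => x * (u x * v x)) (x * v x ^ 2 + (ν ^ 2 / x - x) * u x ^ 2) x := by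
  have h2 := (hasDerivAt_id x).mul ((h.du x hx).mul (h.dv x hx))
  refine HasDerivAt.congr_deriv (h2.congr_of_eventuallyEq (Eventually.of_forall fun y => rfl)) ?_
  simp only [id, Pi.mul_apply]
  field_simp
  ring

lemma coef_nonneg {x : ℝ} (hx : 0 < x) (hxν : x ≤ ν) : 0 ≤ ν ^ 2 / x - x := by
  rw [sub_nonneg, le_div_iff₀ hx]; nlinarith

lemma coef_pos {x : ℝ} (hx : 0 < x) (hxν : x < ν) : 0 < ν ^ 2 / x - x := by
  rw [sub_pos, lt_div_iff₀ hx]; nlinarith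

lemma Sol.xuv_mono (h : Sol ν u v) : MonotoneOn (fun x => x * (u x * v x)) (Ioc 0 ν) := by
  refine monotoneOn_of_deriv_nonneg (convex_Ioc 0 ν)
      (fun x hx => (h.dxuv hx.1).continuousAt.continuousWithinAt) ?_ ?_
  · intro x hx
    rw [interior_Ioc] at hx
    exact (h.dxuv hx.1).differentiableAt.differentiableWithinAt
  · intro x hx
    rw [interior_Ioc] at hx
    rw [(h.dxuv hx.1).deriv]
    have := coef_nonneg hx.1 hx.2.le
    have := hx.1
    positivity

lemma Sol.dsq (h : Sol ν u v) {x : ℝ} (hx : 0 < x) : HasDerivAt (fun x => u x ^ 2) (2 * (u x * v x)) x := by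
  have h2 := (h.du x hx).pow 2
  refine HasDerivAt.congr_deriv (h2.congr_of_eventuallyEq (Eventually.of_forall fun y => rfl)) ?_
  simp; ring

lemma Sol.sq_right (h : Sol ν u v) {a b : ℝ} (ha : 0 < a) (hab : a ≤ b) (hb : b ≤ ν) (h0 : 0 ≤ u a * v a) :
    u a ^ 2 ≤ u b ^ 2 := by
  have hm : MonotoneOn (fun x => u x ^ 2) (Icc a b) := by
    refine monotoneOn_of_deriv_nonneg (convex_Icc a b)
      (fun x hx => (h.dsq (ha.trans_le hx.1)).continuousAt.continuousWithinAt) ?_ ?_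
    · intro x hx
      rw [interior_Icc] at hx
      exact (h.dsq (ha.trans hx.1)).differentiableAt.differentiableWithinAt
    · intro x hx
      rw [interior_Icc] at hx
      have hx0 := ha.trans hx.1
      rw [(h.dsq hx0).deriv]
      have := h.xuv_mono ⟨ha, hab.trans hb⟩ ⟨hx0, hx.2.le.trans hb⟩ hx.1.le
      simp only at this
      have h1 : 0 ≤ a * (u a * v a) := by positivity
      have : 0 ≤ u x * v x := by
        by_contra! hn
        nlinarith
      linarith
  exact hm ⟨le_rfl, hab⟩ ⟨hab, le_rfl⟩ hab

lemma Sol.sq_left (h : Sol ν u v) {a b : ℝ} (ha : 0 < a) (hab : a ≤ b) (hb : b ≤ ν) (h0 : u b * v b ≤ 0) :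
    u b ^ 2 ≤ u a ^ 2 := by
  have hm : AntitoneOn (fun x => u x ^ 2) (Icc a b) := by
    refine antitoneOn_of_deriv_nonpos (convex_Icc a b)
      (fun x hx => (h.dsq (ha.trans_le hx.1)).continuousAt.continuousWithinAt) ?_ ?_
    · intro x hx
      rw [interior_Icc] at hx
      exact (h.dsq (ha.trans hx.1)).differentiableAt.differentiableWithinAt
    · intro x hx
      rw [interior_Icc] at hx
      have hx0 := ha.trans hx.1
      have hb0 := hx0.trans hx.2
      rw [(h.dsq hx0).deriv]
      have := h.xuv_mono ⟨hx0, hx.2.le.trans hb⟩ ⟨hb0, hb⟩ hx.2.le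
      simp only at this
      have : u x * v x ≤ 0 := by
        by_contra! hn
        nlinarith
      linarith
  exact hm ⟨le_rfl, hab⟩ ⟨hab, le_rfl⟩ hab

lemma Sol.uv_pos (h : Sol ν u v) {a b : ℝ} (ha : 0 < a) (hab : a < b) (hb : b ≤ ν) (h0 : 0 ≤ u a * v a) (hu : u a ≠ 0) :
    0 < u b * v b := by
  have hm : StrictMonoOn (fun x => x * (u x * v x)) (Icc a b) := by
    refine strictMonoOn_of_deriv_pos (convex_Icc a b)
      (fun x hx => (h.dxuv (ha.trans_le hx.1)).continuousAt.continuousWithinAt) ?_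
    intro x hx
    rw [interior_Icc] at hx
    have hx0 := ha.trans hx.1
    rw [(h.dxuv hx0).deriv]
    have h1 := coef_pos hx0 (hx.2.trans_le hb)
    have h2 := h.sq_right ha hx.1.le (hx.2.le.trans hb) h0
    have h3 : 0 < u a ^ 2 := by positivity
    have h4 : 0 < u x ^ 2 := by linarith
    have := mul_pos h1 h4
    have := mul_nonneg hx0.le (sq_nonneg (v x))
    linarith
  have := hm ⟨le_rfl, hab.le⟩ ⟨hab.le, le_rfl⟩ hab
  simp only at this
  by_contra! hn
  nlinarith
end

lemma sign_right {f : ℝ → ℝ} {a b : ℝ} (hab : a ≤ b) (hc : ContinuousOn f (Icc a b)) (hn : ∀ x ∈ Icc a b, f x ≠ 0)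
    (ha : 0 < f a) : 0 < f b := by
  by_contra! hb
  obtain ⟨c, hc1, hc2⟩ := intermediate_value_Icc' hab hc ⟨hb, ha.le⟩
  exact hn c hc1 hc2

lemma sign_left {f : ℝ → ℝ} {a b : ℝ} (hab : a ≤ b) (hc : ContinuousOn f (Icc a b)) (hn : ∀ x ∈ Icc a b, f x ≠ 0)
    (hb : 0 < f b) : 0 < f a := by
  by_contra! ha
  obtain ⟨c, hc1, hc2⟩ := intermediate_value_Icc hab hc ⟨ha, hb.le⟩
  exact hn c hc1 hc2

lemma Icc_sub {a b : ℝ} (ha : 0 < a) : Icc a b ⊆ Ioi (0:ℝ) := fun _ hx => ha.trans_le hx.1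

lemma KK_lim0 (ν : ℝ) : Tendsto (fun x => (x / 2) ^ (-ν) * KK ν x) (𝓝[>] 0) (𝓝 (1 / Real.Gamma (ν + 1))) := by
  refine (besselJ_lim ν).congr' ?_
  filter_upwards [self_mem_nhdsWithin] with x hx
  rw [J_eq_K ν hx]

/-- positivity of a limit at the origin -/
lemma dK_lim0 (ν : ℝ) : Tendsto (fun x => (x / 2) ^ (-ν) * (x * dK ν x)) (𝓝[>] 0) (𝓝 (ν * (1 / Real.Gamma (ν + 1)))) := by
  have h1 := ((KK_lim0 ν).const_mul ν).sub ((((tends_pow two_pos).const_mul 2)).mul (KK_lim0 (ν + 1)))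
  rw [mul_zero, zero_mul, sub_zero] at h1
  refine h1.congr' ?_
  filter_upwards [self_mem_nhdsWithin] with y hy
  have hy : 0 < y := hy
  have hh : 0 < y / 2 := by positivity
  have a1 : (y/2)^(-(ν+1)) = ((y/2)^ν)⁻¹ * (y/2)⁻¹ := by
    rw [Real.rpow_neg hh.le, Real.rpow_add hh, Real.rpow_one, mul_inv]
  have a2 : (y/2)^(-ν) = ((y/2)^ν)⁻¹ := by rw [Real.rpow_neg hh.le]
  have a4 : (y/2)^(2:ℝ) = (y/2)^2 := by exact_mod_cast Real.rpow_natCast (y/2) 2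
  rw [a1, a2, a4]
  have : (y/2)^ν ≠ 0 := (Real.rpow_pos_of_pos hh _).ne'
  unfold dK
  field_simp

lemma ev_pos {f : ℝ → ℝ} {p c : ℝ} (hc : 0 < c) (h : Tendsto (fun x => (x / 2) ^ p * f x) (𝓝[>] 0) (𝓝 c)) :
    ∀ᶠ x in 𝓝[>] 0, 0 < f x := by
  filter_upwards [h.eventually (lt_mem_nhds hc), self_mem_nhdsWithin] with x h1 h2
  have h2 : 0 < x := h2
  exact pos_of_mul_pos_right h1 (Real.rpow_pos_of_pos (by positivity) _).le

lemma K_pos {ν : ℝ} (hν : 0 < ν) {x : ℝ} (hx : 0 < x) (hxν : x ≤ ν) : 0 < KK ν x ∧ 0 < dK ν x := by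
  have hG : 0 < Real.Gamma (ν + 1) := Real.Gamma_pos_of_pos (by linarith)
  have e1 := ev_pos (by positivity) (KK_lim0 ν)
  have e2 := ev_pos (by positivity) (dK_lim0 ν)
  obtain ⟨a, h1, h2, ha⟩ := (e1.and (e2.and (Ioo_mem_nhdsGT hx))).exists
  have h3 : 0 < dK ν a := pos_of_mul_pos_right h2 ha.1.le
  have h0 : 0 ≤ KK ν a * dK ν a := by positivity
  have hp : 0 < KK ν x := by
    refine sign_right ha.2.le ((solK ν).cu.mono (Icc_sub ha.1)) ?_ h1
    intro y hy h
    have := (solK ν).sq_right ha.1 hy.1 (hy.2.trans hxν) h0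
    rw [h] at this
    nlinarith
  exact ⟨hp, pos_of_mul_pos_right ((solK ν).uv_pos ha.1 ha.2 hxν h0 h1.ne') hp.le⟩

lemma dY_pos {ν : ℝ} (hν : 0 < ν) {x : ℝ} (hx : 0 < x) (hxν : x ≤ ν) : 0 < dY ν x := by
  have hS := solY ν
  refine sign_left hxν (hS.cv.mono (Icc_sub hx)) ?_ (dY_nu_pos hν)
  intro x0 hx0 h0
  have h00 : 0 < x0 := hx.trans_le hx0.1
  have hu : YY ν x0 ≠ 0 := (Y_nz hν h00).resolve_right (not_not.mpr h0)
  have hu2 : 0 < YY ν x0 ^ 2 := by positivity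
  have hne : x0 ≠ ν := by
    rintro rfl
    have := dY_nu_pos hν
    linarith
  have hlt : x0 < ν := lt_of_le_of_ne hx0.2 hne
  have hv := hS.uv_pos h00 hlt le_rfl (by rw [h0]; simp) hu
  have hvν := dY_nu_pos hν
  have huν : 0 < YY ν ν := pos_of_mul_pos_left hv hvν.le
  have hneg : ∀ᶠ y in 𝓝[>] 0, 0 < - YY ν y := by
    have hl := (YY_lim hν).neg
    simp only [neg_neg, ← mul_neg] at hl
    exact ev_pos (by have := Real.Gamma_pos_of_pos hν; have := Real.pi_pos; positivity) hl
  obtain ⟨a, h1, ha⟩ := (hneg.and (Ioo_mem_nhdsGT hν)).exists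
  have : 0 < YY ν a := by
    refine sign_left ha.2.le (hS.cu.mono (Icc_sub ha.1)) ?_ huν
    intro y hy hy0
    rcases le_total y x0 with h | h
    · have := hS.sq_left (ha.1.trans_le hy.1) h hx0.2 (by rw [h0]; simp)
      rw [hy0] at this; nlinarith
    · have := hS.sq_right h00 h hy.2 (by rw [h0]; simp)
      rw [hy0] at this; nlinarith
  linarith

end BD

namespace BD

open MeasureTheory

noncomputable def Th (ν x θ : ℝ) : ℝ :=
  Real.cos θ ^ 2 + Real.sin θ * Real.cos θ / x + (1 - ν ^ 2 / x ^ 2) * Real.sin θ ^ 2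

structure Phase (ν : ℝ) (u v θ : ℝ → ℝ) : Prop where
  pos : ∀ x, 0 < x → ∃ R, 0 < R ∧ v x = R * Real.cos (θ x) ∧ u x = R * Real.sin (θ x)
  der : ∀ x, 0 < x → HasDerivAt θ (Th ν x (θ x)) x
  init : ∀ x, 0 < x → x ≤ ν → -(π / 2) < θ x ∧ θ x < π / 2

lemma exists_phase {ν : ℝ} {u v : ℝ → ℝ} (hν : 0 < ν) (h : Sol ν u v) (hnz : ∀ x, 0 < x → u x ≠ 0 ∨ v x ≠ 0)
    (hv : ∀ x, 0 < x → x ≤ ν → 0 < v x) : ∃ θ, Phase ν u v θ := by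
  set z : ℝ → ℂ := fun x => (v x : ℂ) + Complex.I * (u x : ℂ) with hz
  set z' : ℝ → ℂ := fun x => ((-(v x) / x - (1 - ν ^ 2 / x ^ 2) * u x : ℝ) : ℂ) + Complex.I * (v x : ℂ) with hz'
  have hre : ∀ x, (z x).re = v x := fun x => by simp [hz]
  have him : ∀ x, (z x).im = u x := fun x => by simp [hz]
  have hre' : ∀ x, (z' x).re = -(v x) / x - (1 - ν ^ 2 / x ^ 2) * u x := fun x => by
    simp only [hz', Complex.add_re, Complex.ofReal_re, Complex.I_mul_re, Complex.ofReal_im, neg_zero, add_zero]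
  have him' : ∀ x, (z' x).im = v x := fun x => by
    simp only [hz', Complex.add_im, Complex.ofReal_im, Complex.I_mul_im, Complex.ofReal_re, zero_add]
  have hz0 : ∀ x, 0 < x → z x ≠ 0 := by
    intro x hx h0
    rcases hnz x hx with h1 | h1
    · apply h1; rw [← him, h0]; rfl
    · apply h1; rw [← hre, h0]; rfl
  have hdz : ∀ x, 0 < x → HasDerivAt z (z' x) x := fun x hx =>
    (h.dv x hx).ofReal_comp.add ((h.du x hx).ofReal_comp.const_mul Complex.I)
  have hzc : ContinuousOn z (Ioi 0) := fun x hx => (hdz x hx).continuousAt.continuousWithinAt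
  have hzc' : ContinuousOn z' (Ioi 0) := by
    have c1 := h.cu
    have c2 := h.cv
    have c3 : ContinuousOn (fun x => -(v x) / x - (1 - ν ^ 2 / x ^ 2) * u x) (Ioi 0) := by
      refine (c2.neg.div continuousOn_id fun x hx => (ne_of_gt hx)).sub ((continuousOn_const.sub
        (continuousOn_const.div (continuousOn_id.pow 2) fun x hx => pow_ne_zero 2 (ne_of_gt hx))).mul c1)
    exact (Complex.continuous_ofReal.comp_continuousOn c3).add
      (continuousOn_const.mul (Complex.continuous_ofReal.comp_continuousOn c2))
  set w : ℝ → ℂ := fun x => z' x / z x with hw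
  have hwc : ContinuousOn w (Ioi 0) := hzc'.div hzc (fun x hx => hz0 x hx)
  set L : ℝ → ℂ := fun x => ∫ t in ν..x, w t with hL
  have hdL : ∀ x, 0 < x → HasDerivAt L (w x) x := by
    intro x hx
    refine intervalIntegral.integral_hasDerivAt_right ?_ (hwc.stronglyMeasurableAtFilter isOpen_Ioi x hx)
      (hwc.continuousAt (Ioi_mem_nhds hx))
    apply ContinuousOn.intervalIntegrable
    refine hwc.mono fun y hy => ?_
    exact lt_of_lt_of_le (lt_min hν hx) hy.1
  have hconst : ∀ x, 0 < x → z x = z ν * Complex.exp (L x) := by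
    intro x hx
    have hd : ∀ y ∈ Ioi (0:ℝ), HasDerivAt (fun y => z y * Complex.exp (-L y)) 0 y := by
      intro y hy
      have h2 := (hdz y hy).mul (hdL y hy).neg.cexp
      refine HasDerivAt.congr_deriv (h2.congr_of_eventuallyEq (Eventually.of_forall fun y => rfl)) ?_
      have := hz0 y hy
      simp only [hw]
      field_simp
      simp
    have := IsOpen.is_const_of_deriv_eq_zero (s := Ioi (0:ℝ)) isOpen_Ioi isPreconnected_Ioi
      (fun y hy => (hd y hy).differentiableAt.differentiableWithinAt) (fun y hy => (hd y hy).deriv) hx hν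
    have hL0 : L ν = 0 := by simp [hL]
    simp only [hL0, neg_zero, Complex.exp_zero, mul_one] at this
    rw [← this, mul_assoc, ← Complex.exp_add]
    simp
  set θ : ℝ → ℝ := fun x => Complex.arg (z ν) + (L x).im with hθ
  have hpos : ∀ x, 0 < x → ∃ R, 0 < R ∧ v x = R * Real.cos (θ x) ∧ u x = R * Real.sin (θ x) := by
    intro x hx
    refine ⟨‖z ν‖ * Real.exp (L x).re, mul_pos (norm_pos_iff.mpr (hz0 ν hν)) (Real.exp_pos _), ?_⟩
    have e : z x = ((‖z ν‖ * Real.exp (L x).re : ℝ) : ℂ) * (Complex.cos (θ x) + Complex.sin (θ x) * Complex.I) := by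
      rw [← Complex.exp_mul_I, hconst x hx]
      conv_lhs => rw [← Complex.norm_mul_exp_arg_mul_I (z ν)]
      simp only [hθ]
      push_cast
      rw [mul_assoc, mul_assoc, ← Complex.exp_add, ← Complex.exp_add]
      congr 2
      conv_lhs => rw [← Complex.re_add_im (L x)]
      ring
    constructor
    · rw [← hre, e, Complex.re_ofReal_mul, ← Complex.ofReal_cos, ← Complex.ofReal_sin, Complex.add_re,
        Complex.re_ofReal_mul, Complex.ofReal_re, Complex.I_re]; ring
    · rw [← him, e, Complex.im_ofReal_mul, ← Complex.ofReal_cos, ← Complex.ofReal_sin, Complex.add_im,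
        Complex.im_ofReal_mul, Complex.ofReal_im, Complex.I_im]; ring
  have hder : ∀ x, 0 < x → HasDerivAt θ (Th ν x (θ x)) x := by
    intro x hx
    have h1 : HasDerivAt (fun x => (L x).im) (w x).im x :=
      (Complex.imCLM.hasFDerivAt (x := L x)).comp_hasDerivAt x (hdL x hx)
    refine (h1.const_add (Complex.arg (z ν))).congr_deriv ?_
    obtain ⟨R, hR, e1, e2⟩ := hpos x hx
    simp only [hw]
    rw [Complex.div_im, Complex.normSq_apply, hre, him, hre', him', e1, e2]
    have hn : R * Real.cos (θ x) * (R * Real.cos (θ x)) + R * Real.sin (θ x) * (R * Real.sin (θ x)) = R ^ 2 := by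
      have := Real.sin_sq_add_cos_sq (θ x)
      linear_combination R ^ 2 * this
    rw [hn]
    unfold Th
    field_simp
    ring
  refine ⟨θ, hpos, hder, fun x hx hxν => ?_⟩
  have hc : ContinuousOn θ (Icc x ν) := fun y hy => (hder y (hx.trans_le hy.1)).continuousAt.continuousWithinAt
  have hcos : ∀ y ∈ Icc x ν, 0 < Real.cos (θ y) := by
    intro y hy
    have hy0 := hx.trans_le hy.1
    obtain ⟨R, hR, e1, -⟩ := hpos y hy0
    have := hv y hy0 hy.2
    rw [e1] at this
    exact pos_of_mul_pos_right this hR.le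
  have hθν : θ ν = Complex.arg (z ν) := by simp [hθ, hL]
  have habs : |Complex.arg (z ν)| < π / 2 :=
    Complex.abs_arg_lt_pi_div_two_iff.mpr (Or.inl (by rw [hre]; exact hv ν hν le_rfl))
  rw [abs_lt] at habs
  constructor
  · have := sign_left (f := fun y => θ y + π / 2) hxν (hc.add continuousOn_const) (fun y hy h0 => by
      have := hcos y hy
      rw [show θ y = -(π / 2) by linarith, Real.cos_neg, Real.cos_pi_div_two] at this
      exact lt_irrefl _ this) (by simp only [hθν]; linarith)
    linarith
  · have := sign_left (f := fun y => π / 2 - θ y) hxν (continuousOn_const.sub hc) (fun y hy h0 => by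
      have := hcos y hy
      rw [show θ y = π / 2 by linarith, Real.cos_pi_div_two] at this
      exact lt_irrefl _ this) (by simp only [hθν]; linarith)
    linarith

lemma crossing {f f' : ℝ → ℝ} {b : ℝ} (hd : ∀ y, b ≤ y → HasDerivAt f (f' y) y) (hz : ∀ y, b ≤ y → f y = 0 → 0 < f' y)
    (hb : 0 ≤ f b) {x : ℝ} (hx : b < x) : 0 < f x := by
  have hnn : ∀ y, b ≤ y → 0 ≤ f y := by
    intro y hy
    refine image_le_of_deriv_right_lt_deriv_boundary' (f := fun _ => (0:ℝ)) (f' := fun _ => 0) (B := f) (B' := f') (a := b) (b := y)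
      continuousOn_const (fun _ _ => hasDerivWithinAt_const _ _ _) hb
      (fun t ht => (hd t ht.1).continuousAt.continuousWithinAt)
      (fun t ht => (hd t ht.1).hasDerivWithinAt) (fun t ht h0 => hz t ht.1 h0.symm) ⟨hy, le_rfl⟩
  rcases (hnn x hx.le).lt_or_eq with h | h
  · exact h
  · exfalso
    have hm : IsLocalMin f x := by
      filter_upwards [Ioi_mem_nhds hx] with y hy
      rw [← h]; exact hnn y (le_of_lt hy)
    have := hm.hasDerivAt_eq_zero (hd x hx.le)
    have := hz x hx.le h.symm
    linarith

section
variable {ν : ℝ} {u v θ : ℝ → ℝ}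

lemma Phase.cont (h : Phase ν u v θ) : ContinuousOn θ (Ioi 0) := fun x hx => (h.der x hx).continuousAt.continuousWithinAt

lemma Phase.up (h : Phase ν u v θ) (hν : 0 < ν) {b x : ℝ} (hb : ν < b) (hx : b < x) (k : ℤ) (hk : π / 2 + k * π ≤ θ b) :
    π / 2 + k * π < θ x := by
  have := crossing (f := fun y => θ y - (π / 2 + k * π)) (f' := fun y => Th ν y (θ y)) (b := b) (x := x)
    (fun y hy => (h.der y (by linarith)).sub_const _) ?_ (by simpa using hk) hx
  · simpa using this
  · intro y hy h0
    have hy0 : 0 < y := by linarith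
    have e : θ y = π / 2 + k * π := by linarith
    have hc : Real.cos (θ y) = 0 := by
      rw [e, add_comm]
      rw [Real.cos_eq_zero_iff]
      exact ⟨k, by ring⟩
    have hs : Real.sin (θ y) ^ 2 = 1 := by rw [Real.sin_sq, hc]; ring
    unfold Th
    rw [hc, hs]
    have : ν ^ 2 / y ^ 2 < 1 := by
      rw [div_lt_one (by positivity)]
      have : ν < y := by linarith
      gcongr
    simp only [ne_eq, OfNat.ofNat_ne_zero, not_false_eq_true, zero_pow, mul_zero, zero_div]
    linarith

lemma Phase.upN (h : Phase ν u v θ) (hν : 0 < ν) {b x : ℝ} (hb : 0 < b) (hx : b < x) (k : ℕ) (hk : π / 2 + k * π ≤ θ b) :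
    π / 2 + k * π < θ x := by
  have : ν < b := by
    by_contra! hle
    have := (h.init b hb hle).2
    have : 0 ≤ k * π := by have := Real.pi_pos; positivity
    linarith
  exact_mod_cast h.up hν this hx k (by exact_mod_cast hk)

lemma Phase.lower (h : Phase ν u v θ) (hν : 0 < ν) {x : ℝ} (hx : 0 < x) : -(π / 2) < θ x := by
  rcases le_or_gt x ν with hle | hgt
  · exact (h.init x hx hle).1
  · have h1 : ∀ᶠ y in 𝓝[>] ν, -(π/2) < θ y :=
      ((h.der ν hν).continuousAt.eventually (lt_mem_nhds (h.init ν hν le_rfl).1)).filter_mono nhdsWithin_le_nhds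
    obtain ⟨b, hb1, hb2⟩ := (h1.and (Ioo_mem_nhdsGT hgt)).exists
    have := h.up hν hb2.1 hb2.2 (-1) (by push_cast; linarith)
    push_cast at this
    linarith

lemma Phase.zero_iff (h : Phase ν u v θ) (hν : 0 < ν) {x : ℝ} (hx : 0 < x) : v x = 0 ↔ ∃ k : ℕ, θ x = π / 2 + k * π := by
  obtain ⟨R, hR, e, -⟩ := h.pos x hx
  rw [e, mul_eq_zero, or_iff_right hR.ne', Real.cos_eq_zero_iff]
  constructor
  · rintro ⟨k, hk⟩
    have hl := h.lower hν hx
    have hp := Real.pi_pos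
    have hk0 : 0 ≤ k := by
      by_contra! hneg
      have : (k:ℝ) ≤ -1 := by exact_mod_cast (by omega : k ≤ -1)
      nlinarith
    obtain ⟨n, rfl⟩ := Int.eq_ofNat_of_zero_le hk0
    refine ⟨n, ?_⟩
    rw [hk]; push_cast; ring
  · rintro ⟨k, hk⟩
    exact ⟨k, by rw [hk]; push_cast; ring⟩

lemma Phase.tends (h : Phase ν u v θ) (hν : 0 < ν) : Tendsto θ atTop atTop := by
  set X := 4 + 2 * ν with hX
  have hlow : ∀ x, X ≤ x → 1 / 2 ≤ Th ν x (θ x) := by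
    intro x hx
    have hx0 : 0 < x := by linarith
    unfold Th
    have h1 := Real.sin_sq_add_cos_sq (θ x)
    have h2 : |Real.sin (θ x) * Real.cos (θ x)| ≤ 1 := by
      rw [abs_mul]; exact mul_le_one₀ (Real.abs_sin_le_one _) (abs_nonneg _) (Real.abs_cos_le_one _)
    have h3 : -(1/4) ≤ Real.sin (θ x) * Real.cos (θ x) / x := by
      rw [le_div_iff₀ hx0]
      have := (abs_le.mp h2).1
      linarith
    have h4 : ν ^ 2 / x ^ 2 ≤ 1 / 4 := by
      rw [div_le_div_iff₀ (by positivity) (by norm_num)]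
      nlinarith
    have h5 : 0 ≤ ν ^ 2 / x ^ 2 := by positivity
    have h6 : Real.sin (θ x) ^ 2 ≤ 1 := Real.sin_sq_le_one _
    nlinarith [sq_nonneg (Real.sin (θ x))]
  have hm : MonotoneOn (fun x => θ x - x / 2) (Ici X) := by
    have hd : ∀ x, X ≤ x → HasDerivAt (fun x => θ x - x / 2) (Th ν x (θ x) - 1 / 2) x := fun x hx =>
      (h.der x (by linarith)).sub ((hasDerivAt_id x).div_const 2)
    refine monotoneOn_of_deriv_nonneg (convex_Ici X) (fun x hx => (hd x hx).continuousAt.continuousWithinAt) ?_ ?_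
    · intro x hx
      rw [interior_Ici] at hx
      exact (hd x (le_of_lt hx)).differentiableAt.differentiableWithinAt
    · intro x hx
      rw [interior_Ici] at hx
      rw [(hd x (le_of_lt hx)).deriv]
      have := hlow x (le_of_lt hx)
      linarith
  have ht : Tendsto (fun x : ℝ => x / 2 + (θ X - X / 2)) atTop atTop :=
    tendsto_atTop_add_const_right _ _ (tendsto_id.atTop_div_const two_pos)
  refine tendsto_atTop_mono' _ ?_ ht
  filter_upwards [eventually_ge_atTop X] with x hx
  have := hm (mem_Ici.mpr le_rfl) (mem_Ici.mpr hx) hx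
  simp only at this
  linarith

lemma Phase.hit (h : Phase ν u v θ) (hν : 0 < ν) {x : ℝ} (hx : 0 < x) (k : ℕ) (hk : π / 2 + k * π ≤ θ x) :
    ∃ a, 0 < a ∧ a ≤ x ∧ θ a = π / 2 + k * π := by
  set y := min ν x with hy
  have hy0 : 0 < y := lt_min hν hx
  have h1 : θ y < π / 2 := (h.init y hy0 (min_le_left _ _)).2
  have h2 : 0 ≤ k * π := by have := Real.pi_pos; positivity
  obtain ⟨a, ha, e⟩ := intermediate_value_Icc (min_le_right ν x) (h.cont.mono (Icc_sub hy0)) ⟨by linarith, hk⟩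
  exact ⟨a, hy0.trans_le ha.1, ha.2, e⟩

end

lemma core_step {μ ν : ℝ} {u v θ U V φ : ℝ → ℝ} (hμ : 0 < μ) (hν : 0 < ν) (h : Phase μ u v θ) (H : Phase ν U V φ)
    (hIntg : InterlaceHalf v V (Ioi 0)) (j : ℕ) : ∀ x, 0 < x → π / 2 + (j + 1) * π ≤ θ x →
      ∃ b, 0 < b ∧ b < x ∧ π / 2 + j * π ≤ φ b := by
  have hp := Real.pi_pos
  have base : ∀ j : ℕ, ∀ x, 0 < x → π / 2 + (j + 1) * π ≤ θ x → ∃ a b, 0 < a ∧ a < b ∧ b < x ∧ θ a = π / 2 + j * π ∧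
      ∃ k : ℕ, φ b = π / 2 + k * π := by
    intro j x hx hj
    obtain ⟨a2, ha2, hle2, e2⟩ := h.hit hμ hx (j + 1) (by push_cast; exact hj)
    obtain ⟨a1, ha1, hle1, e1⟩ := h.hit hμ ha2 j (by rw [e2]; push_cast; linarith)
    have hlt : a1 < a2 := by
      refine lt_of_le_of_ne hle1 ?_
      rintro rfl
      rw [e1] at e2
      push_cast at e2
      linarith
    have z1 : v a1 = 0 := (h.zero_iff hμ ha1).mpr ⟨j, e1⟩
    have z2 : v a2 = 0 := (h.zero_iff hμ ha2).mpr ⟨j + 1, e2⟩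
    obtain ⟨b, ⟨hb, hVb⟩, -⟩ := hIntg a1 ha1 a2 ha2 hlt z1 z2 (by
      intro y hy hvy
      have hy0 := ha1.trans hy.1
      obtain ⟨k, hk⟩ := (h.zero_iff hμ hy0).mp hvy
      have hlow := h.upN hμ ha1 hy.1 j e1.ge
      have hkj : j < k := by
        by_contra! hle
        have : (k:ℝ) ≤ j := by exact_mod_cast hle
        nlinarith
      have hkj' : ((j + 1 : ℕ) : ℝ) ≤ k := by exact_mod_cast hkj
      have := h.upN hμ hy0 hy.2 (j + 1) (by rw [hk]; nlinarith)
      linarith)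
    have hb0 := ha1.trans hb.1
    exact ⟨a1, b, ha1, hb.1, hb.2.trans_le hle2, e1, (H.zero_iff hν hb0).mp hVb⟩
  induction j with
  | zero =>
    intro x hx hj
    obtain ⟨a, b, ha, hab, hbx, -, k, hk⟩ := base 0 x hx hj
    refine ⟨b, ha.trans hab, hbx, ?_⟩
    rw [hk]
    have : 0 ≤ k * π := by positivity
    simpa using this
  | succ j ih =>
    intro x hx hj
    obtain ⟨a, b, ha, hab, hbx, e, k, hk⟩ := base (j + 1) x hx hj
    obtain ⟨b', hb', hb'a, hφ⟩ := ih a ha (by rw [e]; push_cast; linarith)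
    have := H.upN hν hb' (hb'a.trans hab) j hφ
    refine ⟨b, ha.trans hab, hbx, ?_⟩
    rw [hk] at this ⊢
    have hkj : j < k := by
      by_contra! hle
      have : (k:ℝ) ≤ j := by exact_mod_cast hle
      nlinarith
    have : ((j + 1 : ℕ) : ℝ) ≤ k := by exact_mod_cast hkj
    nlinarith

theorem core {μ ν : ℝ} {u v θ U V φ : ℝ → ℝ} (hμ : 0 < μ) (hν : 0 < ν) (h : Phase μ u v θ) (H : Phase ν U V φ)
    (hIntg : InterlaceHalf v V (Ioi 0)) (hgap : ∀ᶠ x in atTop, π < θ x - φ x) : False := by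
  have hp := Real.pi_pos
  obtain ⟨X, hX⟩ := eventually_atTop.mp hgap
  set X0 := max X 1 with hX0
  have hX00 : 0 < X0 := lt_of_lt_of_le one_pos (le_max_right _ _)
  obtain ⟨k, hk⟩ := exists_nat_ge (θ X0 / π)
  have hk2 : θ X0 ≤ k * π := (div_le_iff₀ hp).mp hk
  obtain ⟨x2, hx2, hθ2⟩ := ((eventually_ge_atTop X0).and ((h.tends hμ).eventually_ge_atTop (π / 2 + (k + 1) * π))).exists
  obtain ⟨x1, hx1, e⟩ := intermediate_value_Icc hx2 (h.cont.mono (Icc_sub hX00)) ⟨by nlinarith, hθ2⟩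
  have hx10 : 0 < x1 := hX00.trans_le hx1.1
  obtain ⟨b, hb, hbx, hφ⟩ := core_step hμ hν h H hIntg k x1 hx10 e.ge
  have h1 := H.upN hν hb hbx k hφ
  have h2 := hX x1 ((le_max_left _ _).trans hx1.1)
  linarith

end BD

namespace BD

open MeasureTheory

lemma exists_phJ {ν : ℝ} (hν : 0 < ν) : ∃ θ, Phase ν (KK ν) (dK ν) θ :=
  exists_phase hν (solK ν) (fun _ hx => K_nz hν hx) (fun _ hx h => (K_pos hν hx h).2)

lemma exists_phY {ν : ℝ} (hν : 0 < ν) : ∃ θ, Phase ν (YY ν) (dY ν) θ :=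
  exists_phase hν (solY ν) (fun _ hx => Y_nz hν hx) (fun _ hx h => dY_pos hν hx h)

section
variable {a b : ℝ} {u v θ U V φ : ℝ → ℝ}

lemma norm_polar {R t : ℝ} (hR : 0 < R) : ‖(⟨R * Real.cos t, R * Real.sin t⟩ : ℂ)‖ = R := by
  rw [Complex.norm_def, Complex.normSq_mk]
  have : R * Real.cos t * (R * Real.cos t) + R * Real.sin t * (R * Real.sin t) = R ^ 2 := by
    linear_combination R ^ 2 * (Real.sin_sq_add_cos_sq t)
  rw [this, Real.sqrt_sq hR.le]

lemma Phase.cos_sub (h : Phase a u v θ) (H : Phase b U V φ) {x : ℝ} (hx : 0 < x) :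
    ((⟨v x, u x⟩ : ℂ) * (starRingEnd ℂ) ⟨V x, U x⟩).re / (‖(⟨v x, u x⟩ : ℂ)‖ * ‖(⟨V x, U x⟩ : ℂ)‖) = Real.cos (θ x - φ x) := by
  obtain ⟨R, hR, e1, e2⟩ := h.pos x hx
  obtain ⟨S, hS, f1, f2⟩ := H.pos x hx
  rw [e1, e2, f1, f2, norm_polar hR, norm_polar hS, Complex.mul_re, Complex.conj_re, Complex.conj_im, Real.cos_sub]
  simp only
  field_simp
  ring

lemma Phase.sin_sub (h : Phase a u v θ) (H : Phase b U V φ) {x : ℝ} (hx : 0 < x) (hw : 0 < u x * V x - v x * U x) :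
    0 < Real.sin (θ x - φ x) := by
  obtain ⟨R, hR, e1, e2⟩ := h.pos x hx
  obtain ⟨S, hS, f1, f2⟩ := H.pos x hx
  rw [e1, e2, f1, f2] at hw
  have e : R * Real.sin (θ x) * (S * Real.cos (φ x)) - R * Real.cos (θ x) * (S * Real.sin (φ x)) =
    (R * S) * Real.sin (θ x - φ x) := by rw [Real.sin_sub]; ring
  rw [e] at hw
  exact pos_of_mul_pos_right hw (by positivity)

lemma Th_lip {b x0 y s t : ℝ} (hx0 : 0 < x0) (hy : x0 ≤ y) :
    |Th b y s - Th b y t| ≤ (1 / x0 + b ^ 2 / x0 ^ 2) * |s - t| := by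
  have hy0 : 0 < y := by linarith
  have e : Th b y s - Th b y t = (Real.cos (s + t) / y - b ^ 2 / y ^ 2 * Real.sin (s + t)) * Real.sin (s - t) := by
    unfold Th
    have h1 := Real.sin_sq_add_cos_sq s
    have h2 := Real.sin_sq_add_cos_sq t
    have p1 : Real.sin s * Real.cos s - Real.sin t * Real.cos t = Real.cos (s + t) * Real.sin (s - t) := by
      rw [Real.cos_add, Real.sin_sub]
      linear_combination (-(Real.sin s * Real.cos s)) * h2 + (Real.sin t * Real.cos t) * h1
    have p2 : Real.sin s ^ 2 - Real.sin t ^ 2 = Real.sin (s + t) * Real.sin (s - t) := by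
      rw [Real.sin_add, Real.sin_sub]
      linear_combination (-(Real.sin s ^ 2)) * h2 + (Real.sin t ^ 2) * h1
    have p3 : Real.cos s ^ 2 - Real.cos t ^ 2 = -(Real.sin s ^ 2 - Real.sin t ^ 2) := by linarith
    linear_combination (1 / y) * p1 + p3 + (1 - b ^ 2 / y ^ 2) * p2 - p2 + (p2 - p2)
  rw [e, abs_mul]
  refine mul_le_mul ?_ Real.abs_sin_le_abs (abs_nonneg _) (by positivity)
  refine (abs_sub _ _).trans (add_le_add ?_ ?_)
  · rw [abs_div, abs_of_pos hy0]
    exact div_le_div₀ zero_le_one (Real.abs_cos_le_one _) hx0 hy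
  · rw [abs_mul, abs_of_nonneg (by positivity)]
    calc b ^ 2 / y ^ 2 * |Real.sin (s + t)| ≤ b ^ 2 / y ^ 2 * 1 := by
          gcongr; exact Real.abs_sin_le_one _
      _ ≤ _ := by rw [mul_one]; gcongr

lemma Phase.sturm (h : Phase a u v θ) (H : Phase b U V φ) (ha : 0 < a) (hab : a < b) {x0 x : ℝ} (hx0 : 0 < x0)
    (hx : x0 ≤ x) (h0 : φ x0 < θ x0) : φ x < θ x := by
  set L := 1 / x0 + b ^ 2 / x0 ^ 2 with hL
  set D := fun y => θ y - φ y with hD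
  have hD0 : 0 < D x0 := sub_pos.mpr h0
  have key : (fun y => D x0 * Real.exp (-(L + 1) * (y - x0))) x ≤ D x := by
    refine image_le_of_deriv_right_lt_deriv_boundary' (f := fun y => D x0 * Real.exp (-(L + 1) * (y - x0)))
      (f' := fun y => D x0 * (Real.exp (-(L + 1) * (y - x0)) * (-(L + 1) * 1))) (B := D)
      (B' := fun y => Th a y (θ y) - Th b y (φ y)) (a := x0) (b := x) ?_ ?_ ?_ ?_ ?_ ?_ ⟨hx, le_rfl⟩
    · fun_prop
    · intro y _
      exact (((((hasDerivAt_id y).sub_const x0).const_mul (-(L + 1))).exp).const_mul (D x0)).hasDerivWithinAt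
    · simp
    · exact ((h.cont.sub H.cont).mono (Icc_sub hx0))
    · intro y hy
      have hy0 : 0 < y := hx0.trans_le hy.1
      exact ((h.der y hy0).sub (H.der y hy0)).hasDerivWithinAt
    · intro y hy e
      have hy0 : 0 < y := hx0.trans_le hy.1
      have hDy : 0 < D y := by rw [← e]; exact mul_pos hD0 (Real.exp_pos _)
      have e' : D x0 * (Real.exp (-(L + 1) * (y - x0)) * (-(L + 1) * 1)) = -(L + 1) * D y := by
        rw [← e]; ring
      rw [e']
      have l1 := (abs_le.mp (Th_lip (b := b) (s := θ y) (t := φ y) hx0 hy.1)).1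
      rw [abs_of_pos (show 0 < θ y - φ y from hDy)] at l1
      have l2 : Th b y (θ y) ≤ Th a y (θ y) := by
        unfold Th
        have : a ^ 2 / y ^ 2 ≤ b ^ 2 / y ^ 2 := by gcongr
        nlinarith [sq_nonneg (Real.sin (θ y))]
      have : D y = θ y - φ y := rfl
      rw [← this, ← hL] at l1
      nlinarith
  have : 0 < D x0 * Real.exp (-(L + 1) * (x - x0)) := mul_pos hD0 (Real.exp_pos _)
  have : 0 < D x := lt_of_lt_of_le this key
  simp only [hD] at this
  linarith

end

lemma K_wr_near {a b : ℝ} (ha : 0 < a) (hab : a < b) :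
    ∀ᶠ x in 𝓝[>] 0, 0 < KK a x * dK b x - dK a x * KK b x := by
  have h1 := ((KK_lim0 a).mul (dK_lim0 b)).sub ((dK_lim0 a).mul (KK_lim0 b))
  have hGa : 0 < Real.Gamma (a + 1) := Real.Gamma_pos_of_pos (by linarith)
  have hGb : 0 < Real.Gamma (b + 1) := Real.Gamma_pos_of_pos (by linarith)
  have hc : 0 < 1 / Real.Gamma (a + 1) * (b * (1 / Real.Gamma (b + 1))) - a * (1 / Real.Gamma (a + 1)) * (1 / Real.Gamma (b + 1)) := by
    have e : 1 / Real.Gamma (a + 1) * (b * (1 / Real.Gamma (b + 1))) - a * (1 / Real.Gamma (a + 1)) * (1 / Real.Gamma (b + 1)) = (b - a) * (1 / Real.Gamma (a + 1) * (1 / Real.Gamma (b + 1))) := by ring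
    rw [e]
    have : 0 < b - a := by linarith
    positivity
  filter_upwards [h1.eventually (lt_mem_nhds hc), self_mem_nhdsWithin] with x hx hx0
  have hx0 : 0 < x := hx0
  have e : (x / 2) ^ (-a) * KK a x * ((x / 2) ^ (-b) * (x * dK b x)) - (x / 2) ^ (-a) * (x * dK a x) * ((x / 2) ^ (-b) * KK b x)
    = ((x / 2) ^ (-a) * (x / 2) ^ (-b) * x) * (KK a x * dK b x - dK a x * KK b x) := by ring
  rw [e] at hx
  refine pos_of_mul_pos_right hx ?_
  have := Real.rpow_pos_of_pos (by positivity : 0 < x / 2) (-a)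
  have := Real.rpow_pos_of_pos (by positivity : 0 < x / 2) (-b)
  positivity

lemma JJ_lt {a b : ℝ} {θ φ : ℝ → ℝ} (ha : 0 < a) (hab : a < b) (h : Phase a (KK a) (dK a) θ) (H : Phase b (KK b) (dK b) φ)
    {x : ℝ} (hx : 0 < x) : φ x < θ x := by
  obtain ⟨x0, hw, hx0⟩ := ((K_wr_near ha hab).and (Ioo_mem_nhdsGT (lt_min ha hx))).exists
  have hxa : x0 ≤ a := hx0.2.le.trans (min_le_left _ _)
  have hxx : x0 ≤ x := hx0.2.le.trans (min_le_right _ _)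
  refine h.sturm H ha hab hx0.1 hxx ?_
  have hs := h.sin_sub H hx0.1 hw
  have i1 := h.init x0 hx0.1 hxa
  have i2 := H.init x0 hx0.1 (hxa.trans hab.le)
  by_contra! hle
  have : Real.sin (θ x0 - φ x0) ≤ 0 := Real.sin_nonpos_of_nonpos_of_neg_pi_le (by linarith) (by linarith)
  linarith

lemma JJ_cos {a b : ℝ} {θ φ : ℝ → ℝ} (h : Phase a (KK a) (dK a) θ) (H : Phase b (KK b) (dK b) φ) :
    Tendsto (fun x => Real.cos (θ x - φ x)) atTop (𝓝 (Real.cos ((b - a) * π / 2))) := by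
  obtain ⟨C1, h1⟩ := z_asym a
  obtain ⟨C2, h2⟩ := z_asym b
  have l := cos_lim (fun x hx => (h1 x hx).1) (fun x hx => (h2 x hx).1)
    (by rw [norm_mul, ph_norm, Complex.norm_I, one_mul]) (by rw [norm_mul, ph_norm, Complex.norm_I, one_mul])
  have e : (Complex.I * ph (a * π / 2) * (starRingEnd ℂ) (Complex.I * ph (b * π / 2))).re = Real.cos ((b - a) * π / 2) := by
    have e2 : (b - a) * π / 2 = b * π / 2 - a * π / 2 := by ring
    rw [map_mul, Complex.conj_I, e2, Real.cos_sub, ← ph_re, ← ph_re]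
    have s1 : Real.sin (b * π / 2) = -(ph (b * π / 2)).im := by rw [ph_im]; ring
    have s2 : Real.sin (a * π / 2) = -(ph (a * π / 2)).im := by rw [ph_im]; ring
    rw [s1, s2]
    have : Complex.I * ph (a * π / 2) * (-Complex.I * (starRingEnd ℂ) (ph (b * π / 2))) = ph (a * π / 2) * (starRingEnd ℂ) (ph (b * π / 2)) := by
      linear_combination (-(ph (a * π / 2) * (starRingEnd ℂ) (ph (b * π / 2)))) * Complex.I_mul_I
    rw [this, Complex.mul_re, Complex.conj_re, Complex.conj_im]
    ring
  rw [e] at l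
  refine l.congr' ?_
  filter_upwards [eventually_gt_atTop 0] with x hx
  exact h.cos_sub H hx

lemma JJ_gap {a b ε : ℝ} {θ φ : ℝ → ℝ} (ha : 0 < a) (hab : a < b) (hb : b ≤ a + 2) (hε : 0 < ε)
    (h : Phase a (KK a) (dK a) θ) (H : Phase b (KK b) (dK b) φ) :
    ∀ᶠ x in atTop, (b - a) * π / 2 - ε < θ x - φ x := by
  have hp := Real.pi_pos
  have l := (Real.continuous_arccos.tendsto _).comp (JJ_cos h H)
  rw [Real.arccos_cos (by have : 0 < b - a := by linarith
                          positivity) (by nlinarith)] at l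
  filter_upwards [l.eventually (lt_mem_nhds (sub_lt_self _ hε)), eventually_gt_atTop 0] with x h1 h2
  have hlt := JJ_lt ha hab h H h2
  rcases le_or_gt (θ x - φ x) π with h3 | h3
  · simp only [Function.comp] at h1
    rwa [Real.arccos_cos (by linarith) h3] at h1
  · nlinarith

lemma JY_range {ν : ℝ} {θ φ : ℝ → ℝ} (hν : 0 < ν) (h : Phase ν (KK ν) (dK ν) θ) (H : Phase ν (YY ν) (dY ν) φ)
    {x : ℝ} (hx : 0 < x) : 0 < θ x - φ x ∧ θ x - φ x < π := by
  have hp := Real.pi_pos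
  have hs : ∀ y, 0 < y → 0 < Real.sin (θ y - φ y) := fun y hy =>
    h.sin_sub H hy (by rw [KY_wr hν hy]; positivity)
  have i1 := h.init ν hν le_rfl
  have i2 := H.init ν hν le_rfl
  have h0 : 0 < θ ν - φ ν := by
    by_contra! hle
    have : Real.sin (θ ν - φ ν) ≤ 0 := Real.sin_nonpos_of_nonpos_of_neg_pi_le (by linarith) (by linarith)
    linarith [hs ν hν]
  have hc := h.cont.sub H.cont
  have n1 : ∀ y, 0 < y → θ y - φ y ≠ 0 := fun y hy e => by
    have := hs y hy; rw [e, Real.sin_zero] at this; exact lt_irrefl _ this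
  have n2 : ∀ y, 0 < y → π - (θ y - φ y) ≠ 0 := fun y hy e => by
    have := hs y hy; rw [show θ y - φ y = π by linarith, Real.sin_pi] at this; exact lt_irrefl _ this
  have h1 : 0 < π - (θ ν - φ ν) := by linarith
  rcases le_total x ν with hle | hle
  · have r1 := sign_left (f := fun y => θ y - φ y) hle (hc.mono (Icc_sub hx)) (fun y hy => n1 y (hx.trans_le hy.1)) h0
    have r2 := sign_left (f := fun y => π - (θ y - φ y)) hle (continuousOn_const.sub (hc.mono (Icc_sub hx))) (fun y hy => n2 y (hx.trans_le hy.1)) h1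
    exact ⟨r1, by linarith⟩
  · have r1 := sign_right (f := fun y => θ y - φ y) hle (hc.mono (Icc_sub hν)) (fun y hy => n1 y (hν.trans_le hy.1)) h0
    have r2 := sign_right (f := fun y => π - (θ y - φ y)) hle (continuousOn_const.sub (hc.mono (Icc_sub hν))) (fun y hy => n2 y (hν.trans_le hy.1)) h1
    exact ⟨r1, by linarith⟩

lemma JY_lim {ν : ℝ} {θ φ : ℝ → ℝ} (hν : 0 < ν) (h : Phase ν (KK ν) (dK ν) θ) (H : Phase ν (YY ν) (dY ν) φ) :
    Tendsto (fun x => θ x - φ x) atTop (𝓝 (π / 2)) := by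
  obtain ⟨C1, h1⟩ := z_asym ν
  have l := cos_lim (fun x hx => (h1 x hx).1) (fun x hx => (h1 x hx).2)
    (by rw [norm_mul, ph_norm, Complex.norm_I, one_mul]) (ph_norm _)
  have e : (Complex.I * ph (ν * π / 2) * (starRingEnd ℂ) (ph (ν * π / 2))).re = 0 := by
    rw [mul_assoc, Complex.mul_conj, Complex.I_mul_re, Complex.ofReal_im, neg_zero]
  rw [e] at l
  have l2 := (Real.continuous_arccos.tendsto _).comp l
  rw [Real.arccos_zero] at l2
  refine l2.congr' ?_
  filter_upwards [eventually_gt_atTop 0] with x hx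
  have r := JY_range hν h H hx
  have := h.cos_sub H hx
  simp only [Function.comp]
  rw [show zJ ν x = ⟨dK ν x, KK ν x⟩ from rfl, show zY ν x = ⟨dY ν x, YY ν x⟩ from rfl, this, Real.arccos_cos r.1.le r.2.le]

lemma JJ_big {μ ν : ℝ} {θ φ : ℝ → ℝ} (hμ : 0 < μ) (hsep : μ + 2 < ν) (h : Phase μ (KK μ) (dK μ) θ) (H : Phase ν (KK ν) (dK ν) φ) :
    ∃ ε, 0 < ε ∧ ∀ᶠ x in atTop, π + 3 * ε < θ x - φ x := by
  have hp := Real.pi_pos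
  set s := min (ν - μ - 2) 1 with hs
  have hs0 : 0 < s := lt_min (by linarith) one_pos
  have hs1 : s ≤ 1 := min_le_right _ _
  have hs2 : s ≤ ν - μ - 2 := min_le_left _ _
  have hm : 0 < μ + 2 := by linarith
  have hb : 0 < μ + 2 + s := by linarith
  obtain ⟨θ2, P2⟩ := exists_phJ hm
  obtain ⟨θ3, P3⟩ := exists_phJ hb
  have hε : 0 < s * π / 10 := by positivity
  refine ⟨s * π / 10, hε, ?_⟩
  have g1 := JJ_gap hμ (by linarith) (by linarith) hε h P2
  have g2 := JJ_gap hm (by linarith : μ + 2 < μ + 2 + s) (by linarith) hε P2 P3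
  rcases hs2.eq_or_lt with he | hlt
  · have hbν : μ + 2 + s = ν := by linarith
    have g3 := JJ_gap hm (by linarith : μ + 2 < ν) (by linarith) hε P2 H
    filter_upwards [g1, g3] with x e1 e3
    have r : (ν - (μ + 2)) * π / 2 = s * π / 2 := by rw [← hbν]; ring
    rw [r] at e3
    have r2 : (μ + 2 - μ) * π / 2 = π := by ring
    rw [r2] at e1
    linarith
  · filter_upwards [g1, g2, eventually_gt_atTop 0] with x e1 e2 hx
    have e3 := JJ_lt hb (by linarith : μ + 2 + s < ν) P3 H hx
    have r : (μ + 2 + s - (μ + 2)) * π / 2 = s * π / 2 := by ring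
    rw [r] at e2
    have r2 : (μ + 2 - μ) * π / 2 = π := by ring
    rw [r2] at e1
    linarith

lemma notJ {μ ν : ℝ} (hμ : 0 < μ) (hsep : μ + 2 < ν) : ¬ InterlaceHalf (dK μ) (dK ν) (Ioi 0) := by
  intro hIntg
  have hν : 0 < ν := by linarith
  obtain ⟨θ, h⟩ := exists_phJ hμ
  obtain ⟨φ, H⟩ := exists_phJ hν
  obtain ⟨ε, hε, hb⟩ := JJ_big hμ hsep h H
  exact core hμ hν h H hIntg (hb.mono fun x hx => by linarith)

lemma notY {μ ν : ℝ} (hμ : 0 < μ) (hsep : μ + 2 < ν) : ¬ InterlaceHalf (dY μ) (dY ν) (Ioi 0) := by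
  intro hIntg
  have hν : 0 < ν := by linarith
  obtain ⟨θ, h⟩ := exists_phJ hμ
  obtain ⟨φ, H⟩ := exists_phJ hν
  obtain ⟨α, k⟩ := exists_phY hμ
  obtain ⟨β, K⟩ := exists_phY hν
  obtain ⟨ε, hε, hb⟩ := JJ_big hμ hsep h H
  have l1 := (JY_lim hμ h k).eventually (gt_mem_nhds (lt_add_of_pos_right _ hε))
  have l2 := (JY_lim hν H K).eventually (lt_mem_nhds (sub_lt_self _ hε))
  refine core hμ hν k K hIntg ?_
  filter_upwards [hb, l1, l2] with x e1 e2 e3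
  linarith

lemma deriv_J (ν : ℝ) {x : ℝ} (hx : 0 < x) : deriv (besselJ ν) x = dK ν x := by
  rw [(besselJ_hasDerivAt ν hx).deriv, J_eq_K ν hx, J_eq_K (ν + 1) hx]; rfl

lemma deriv_Y (ν : ℝ) {x : ℝ} (hx : 0 < x) : deriv (besselY ν) x = dY ν x := by
  have : HasDerivAt (besselY ν) (dY ν x) x := by
    refine (YY_hasDerivAt ν hx).congr_of_eventuallyEq ?_
    filter_upwards [Ioi_mem_nhds hx] with y hy using Y_eq_YY ν hy
  exact this.deriv

lemma half_congr {f g f' g' : ℝ → ℝ} (hf : ∀ x, 0 < x → f x = f' x) (hg : ∀ x, 0 < x → g x = g' x)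
    (h : InterlaceHalf f g (Ioi 0)) : InterlaceHalf f' g' (Ioi 0) := by
  intro x₁ h1 x₂ h2 hlt e1 e2 hne
  have h1' : 0 < x₁ := h1
  obtain ⟨b, ⟨hb, hgb⟩, huniq⟩ := h x₁ h1 x₂ h2 hlt (by rw [hf _ h1, e1]) (by rw [hf _ h2, e2])
    (fun x hx => by rw [hf x (h1'.trans hx.1)]; exact hne x hx)
  refine ⟨b, ⟨hb, by rw [← hg b (h1'.trans hb.1), hgb]⟩, fun y hy => huniq y ⟨hy.1, ?_⟩⟩
  rw [hg y (h1'.trans hy.1.1), hy.2]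

end BD

/-- For `ν, μ > 0` with `|ν − μ| > 2`, the positive zeros of `J_ν′` and `J_μ′` are not
interlaced on `(0,∞)`, and neither are those of `Y_ν′` and `Y_μ′`. -/
theorem bessel_deriv_not_interlaced (ν μ : ℝ) (hν : 0 < ν) (hμ : 0 < μ)
    (hsep : 2 < |ν - μ|) :
    ¬ InterlacedOn (deriv (besselJ ν)) (deriv (besselJ μ)) (Set.Ioi 0) ∧
      ¬ InterlacedOn (deriv (besselY ν)) (deriv (besselY μ)) (Set.Ioi 0) := by
  rcases lt_abs.mp hsep with h | h
  · refine ⟨fun hI => BD.notJ hμ (by linarith : μ + 2 < ν) ?_, fun hI => BD.notY hμ (by linarith : μ + 2 < ν) ?_⟩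
    · exact BD.half_congr (fun x hx => BD.deriv_J μ hx) (fun x hx => BD.deriv_J ν hx) hI.2
    · exact BD.half_congr (fun x hx => BD.deriv_Y μ hx) (fun x hx => BD.deriv_Y ν hx) hI.2
  · refine ⟨fun hI => BD.notJ hν (by linarith : ν + 2 < μ) ?_, fun hI => BD.notY hν (by linarith : ν + 2 < μ) ?_⟩
    · exact BD.half_congr (fun x hx => BD.deriv_J ν hx) (fun x hx => BD.deriv_J μ hx) hI.1
    · exact BD.half_congr (fun x hx => BD.deriv_Y ν hx) (fun x hx => BD.deriv_Y μ hx) hI.1
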